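/- Let Γ be a countable discrete group and let f : C → C' be a cochain map of based free ℤΓ-cochain complexes which is a chain homotopy equivalence over ℤΓ. Let C_f be the mapping cone of f, the based free ℤΓ-cochain complex with C_f^j = C^j ⊕ C'^{j-1}, differential d(c, c') = (d_C c, f(c) − d_{C'} c'), and the direct-sum bases. Assume that C, C' and C_f are all ℓ²-acyclic with spectral gap, with Laplacians Δ_j, Δ'_j and Δ_j^{C_f} respectively. Then the L² torsion of the mapping cone equals the quotient of the L² torsions: ∏_j Det_τ(Δ_j^{C_f})^{(-1)^j · j} = (∏_j Det_τ(Δ_j)^{(-1)^j · j}) · (∏_j Det_τ(Δ'_j)^{(-1)^j · j})^{-1}. -/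

import Mathlib

set_option maxHeartbeats 1000000
set_option synthInstance.maxHeartbeats 1000000

/-- Completeness of finite `L^p` products of complete spaces. -/
instance PiLp.instCompleteSpace {ι : Type} (p : ENNReal) (E : ι → Type)
    [∀ i, UniformSpace (E i)] [∀ i, CompleteSpace (E i)] : CompleteSpace (PiLp p E) :=
  (PiLp.uniformEquiv p E).completeSpace_iff.2 (Pi.complete E)

noncomputable section

open scoped ENNReal

/-- `ℓ²(Γ)`, the Hilbert space of square-summable complex functions on `Γ`. -/
abbrev l2 (Γ : Type) : Type := lp (fun _ : Γ => ℂ) 2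

variable {Γ : Type} [Group Γ]

theorem translate_memℓp (γ : Γ) (f : l2 Γ) :
    Memℓp (fun x : Γ => f (x * γ)) (2 : ℝ≥0∞) := by
  have h2 : (0:ℝ) < (2 : ℝ≥0∞).toReal := by norm_num
  apply memℓp_gen
  have hs : Summable fun i : Γ => ‖f i‖ ^ (2 : ℝ≥0∞).toReal := (lp.memℓp f).summable h2
  exact ((Equiv.mulRight γ).summable_iff (f := fun i : Γ => ‖f i‖ ^ (2 : ℝ≥0∞).toReal)).2 hs

/-- The right-translation unitary `(ρ_γ ξ)(x) = ξ(xγ)` on `ℓ²(Γ)`. -/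
def rhoEquiv (γ : Γ) : l2 Γ ≃ₗᵢ[ℂ] l2 Γ where
  toFun f := ⟨fun x => f (x * γ), translate_memℓp γ f⟩
  invFun f := ⟨fun x => f (x * γ⁻¹), translate_memℓp γ⁻¹ f⟩
  left_inv f := by ext x; simp
  right_inv f := by ext x; simp
  map_add' f g := by ext x; rfl
  map_smul' c f := by ext x; simp [lp.coeFn_smul]
  norm_map' f := by
    have h2 : (0:ℝ) < (2 : ℝ≥0∞).toReal := by norm_num
    have h1 := lp.norm_rpow_eq_tsum h2
      (⟨fun x => f (x * γ), translate_memℓp γ f⟩ : l2 Γ)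
    have h3 := lp.norm_rpow_eq_tsum h2 f
    have h4 : ∑' x : Γ, ‖f (x * γ)‖ ^ (2 : ℝ≥0∞).toReal
        = ∑' x : Γ, ‖f x‖ ^ (2 : ℝ≥0∞).toReal :=
      (Equiv.mulRight γ).tsum_eq fun x => ‖f x‖ ^ (2 : ℝ≥0∞).toReal
    have h5 := h1.trans (h4.trans h3.symm)
    have h6 : (2 : ℝ≥0∞).toReal = (2:ℝ) := by norm_num
    rw [h6] at h5
    have h7 : ∀ a : ℝ, 0 ≤ a → Real.sqrt (a ^ (2:ℝ)) = a := by
      intro a ha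
      rw [show ((2:ℝ)) = ((2:ℕ):ℝ) by norm_num, Real.rpow_natCast]
      exact Real.sqrt_sq ha
    calc ‖(⟨fun x => f (x * γ), translate_memℓp γ f⟩ : l2 Γ)‖
        = Real.sqrt (‖(⟨fun x => f (x * γ), translate_memℓp γ f⟩ : l2 Γ)‖ ^ (2:ℝ)) :=
          (h7 _ (norm_nonneg _)).symm
      _ = Real.sqrt (‖f‖ ^ (2:ℝ)) := by rw [h5]
      _ = ‖f‖ := h7 _ (norm_nonneg _)

/-- The right-translation unitary as a bounded operator on `ℓ²(Γ)`. -/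
def rho (γ : Γ) : l2 Γ →L[ℂ] l2 Γ :=
  ((rhoEquiv γ).toContinuousLinearEquiv : l2 Γ ≃L[ℂ] l2 Γ).toContinuousLinearMap

/-- For `a = Σ_γ a(γ)γ ∈ ℤΓ`, the operator `R_a := Σ_γ a(γ) ρ_γ` on `ℓ²(Γ)`. -/
def Rop (a : MonoidAlgebra ℤ Γ) : l2 Γ →L[ℂ] l2 Γ :=
  a.coeff.sum fun γ k => (k : ℂ) • rho γ

/-- `ℓ²(Γ)ⁿ`, indexed by a finite type `ι`. -/
abbrev Hn (Γ : Type) [Group Γ] (ι : Type) [Fintype ι] : Type :=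
  PiLp 2 fun _ : ι => l2 Γ

def projL (Γ : Type) [Group Γ] {ι : Type} [Fintype ι] (j : ι) : Hn Γ ι →L[ℂ] l2 Γ :=
  (ContinuousLinearMap.proj j).comp
    (PiLp.continuousLinearEquiv 2 ℂ (fun _ : ι => l2 Γ)).toContinuousLinearMap

def inclL (Γ : Type) [Group Γ] {ι : Type} [Fintype ι] [DecidableEq ι] (i : ι) :
    l2 Γ →L[ℂ] Hn Γ ι :=
  ((PiLp.continuousLinearEquiv 2 ℂ (fun _ : ι => l2 Γ)).symm.toContinuousLinearMap).comp
    { toLinearMap := LinearMap.single ℂ (fun _ : ι => l2 Γ) i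
      cont := by
        show Continuous fun x : l2 Γ => (LinearMap.single ℂ (fun _ : ι => l2 Γ) i) x
        refine continuous_pi fun j => ?_
        show Continuous fun x : l2 Γ => (LinearMap.single ℂ (fun _ : ι => l2 Γ) i) x j
        by_cases h : j = i
        · subst h
          have hfun : (fun x : l2 Γ => (LinearMap.single ℂ (fun _ : ι => l2 Γ) j) x j)
              = fun x => x := by funext x; simp
          rw [hfun]; exact continuous_id
        · have hfun : (fun x : l2 Γ => (LinearMap.single ℂ (fun _ : ι => l2 Γ) i) x j)
              = fun _ => 0 := by funext x; simp [Pi.single_eq_of_ne h]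
          rw [hfun]; exact continuous_const }

/-- For a matrix `A = (a_{ij})` over `ℤΓ`, the bounded operator `R_A` on `ℓ²(Γ)ⁿ`
whose `(i,j)` entry is `R_{a_{ij}}`. -/
def RA {ι κ : Type} [Fintype ι] [Fintype κ] (A : Matrix ι κ (MonoidAlgebra ℤ Γ)) :
    Hn Γ κ →L[ℂ] Hn Γ ι :=
  letI := Classical.decEq ι
  ∑ i, ∑ j, (inclL Γ i).comp ((Rop (A i j)).comp (projL Γ j))

/-- The vector `δ_e ⊗ e_i ∈ ℓ²(Γ)ⁿ`. -/
def deltaE (Γ : Type) [Group Γ] {ι : Type} [Fintype ι] (i : ι) : Hn Γ ι :=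
  letI := Classical.decEq ι
  letI := Classical.decEq Γ
  (PiLp.continuousLinearEquiv 2 ℂ (fun _ : ι => l2 Γ)).symm
    (Pi.single i (lp.single 2 (1 : Γ) 1))

/-- The von Neumann trace `τ(T) := Σ_i ⟨T(δ_e ⊗ e_i), δ_e ⊗ e_i⟩`. -/
def vnTrace {ι : Type} [Fintype ι] (T : Hn Γ ι →L[ℂ] Hn Γ ι) : ℂ :=
  ∑ i, inner (𝕜 := ℂ) (T (deltaE Γ i)) (deltaE Γ i)

instance {ι : Type} [Fintype ι] :
    ContinuousFunctionalCalculus ℝ (Hn Γ ι →L[ℂ] Hn Γ ι) IsSelfAdjoint :=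
  (IsSelfAdjoint.instIsometricContinuousFunctionalCalculus
    (A := Hn Γ ι →L[ℂ] Hn Γ ι)).toContinuousFunctionalCalculus

/-- The Fuglede–Kadison determinant
`Det_τ(T) := exp(½ Re τ(log (T*T)))`, where `log(T*T)` is given by the continuous
functional calculus. -/
def FKdet {ι : Type} [Fintype ι] (T : Hn Γ ι →L[ℂ] Hn Γ ι) : ℝ :=
  Real.exp ((1 / 2) * (vnTrace (cfc Real.log (star T * T))).re)

/-- A based free `ℤΓ`-cochain complex `0 → C⁰ → ⋯ → C^N → 0`. -/
structure BasedFreeComplex (Γ : Type) [Group Γ] where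
  N : ℕ
  basis : ℕ → Type
  fintype : ∀ j, Fintype (basis j)
  bounded : ∀ j, N < j → IsEmpty (basis j)
  d : (j : ℕ) → Matrix (basis (j + 1)) (basis j) (MonoidAlgebra ℤ Γ)
  dd : ∀ j, d (j + 1) * d j = 0

attribute [instance] BasedFreeComplex.fintype

/-- The `j`-th Laplacian `Δ_j := R_{D_j}* R_{D_j} + R_{D_{j-1}} R_{D_{j-1}}*` of the
`ℓ²`-completion of a based free complex. -/
def BasedFreeComplex.lap (C : BasedFreeComplex Γ) :
    (j : ℕ) → (Hn Γ (C.basis j) →L[ℂ] Hn Γ (C.basis j))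
  | 0 => (ContinuousLinearMap.adjoint (RA (C.d 0))).comp (RA (C.d 0))
  | (j + 1) =>
      (ContinuousLinearMap.adjoint (RA (C.d (j + 1)))).comp (RA (C.d (j + 1)))
        + (RA (C.d j)).comp (ContinuousLinearMap.adjoint (RA (C.d j)))

/-- `C` is `ℓ²`-acyclic with spectral gap: all Laplacians are invertible. -/
def BasedFreeComplex.AcyclicWithGap (C : BasedFreeComplex Γ) : Prop :=
  ∀ j, IsUnit (C.lap j)

/-- The `L²` torsion `∏_j Det_τ(Δ_j)^{(-1)^j j}`. -/
def BasedFreeComplex.torsion (C : BasedFreeComplex Γ) : ℝ :=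
  ∏ j ∈ Finset.range (C.N + 1), FKdet (C.lap j) ^ ((-1 : ℤ) ^ j * (j : ℤ))

/-- A cochain map between based free complexes, given in each degree by a matrix over `ℤΓ`. -/
structure CochainMap (C C' : BasedFreeComplex Γ) where
  f : (j : ℕ) → Matrix (C'.basis j) (C.basis j) (MonoidAlgebra ℤ Γ)
  comm : ∀ j, f (j + 1) * C.d j = C'.d j * f j

/-- The identity cochain map. -/
def CochainMap.id (C : BasedFreeComplex Γ) : CochainMap C C where
  f := fun j => letI := Classical.decEq (C.basis j); 1
  comm := fun j => by
    letI := Classical.decEq (C.basis j)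
    letI := Classical.decEq (C.basis (j + 1))
    simp

/-- Composition of cochain maps. -/
def CochainMap.comp {C C' C'' : BasedFreeComplex Γ}
    (g : CochainMap C' C'') (f : CochainMap C C') : CochainMap C C'' where
  f := fun j => g.f j * f.f j
  comm := fun j => by
    rw [Matrix.mul_assoc, f.comm j, ← Matrix.mul_assoc, g.comm j, Matrix.mul_assoc]

/-- Two cochain maps are chain homotopic over `ℤΓ`. -/
def CochainMap.Homotopic {C C' : BasedFreeComplex Γ} (φ ψ : CochainMap C C') : Prop :=
  ∃ h : (j : ℕ) → Matrix (C'.basis j) (C.basis (j + 1)) (MonoidAlgebra ℤ Γ),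
    ψ.f 0 - φ.f 0 = h 0 * C.d 0 ∧
    ∀ j, ψ.f (j + 1) - φ.f (j + 1) = h (j + 1) * C.d (j + 1) + C'.d j * h j

/-- A cochain map is a chain homotopy equivalence over `ℤΓ`. -/
def CochainMap.IsHomotopyEquivalence {C C' : BasedFreeComplex Γ} (φ : CochainMap C C') : Prop :=
  ∃ ψ : CochainMap C' C,
    (ψ.comp φ).Homotopic (CochainMap.id C) ∧ (φ.comp ψ).Homotopic (CochainMap.id C')

/-- The basis types of the mapping cone: `C_f^j = C^j ⊕ C'^{j-1}` (with `C'^{-1} = 0`). -/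
def coneBasis (C C' : BasedFreeComplex Γ) : ℕ → Type
  | 0 => C.basis 0 ⊕ Empty
  | (j + 1) => C.basis (j + 1) ⊕ C'.basis j

instance (C C' : BasedFreeComplex Γ) (j : ℕ) : Fintype (coneBasis C C' j) := by
  cases j <;> (unfold coneBasis; infer_instance)

/-- The mapping cone `C_f` of a cochain map `f : C → C'`, with differential
`d(c, c') = (d_C c, f(c) − d_{C'} c')` and the direct-sum bases. -/
def mappingCone {C C' : BasedFreeComplex Γ} (φ : CochainMap C C') : BasedFreeComplex Γ where
  N := max C.N (C'.N + 1)
  basis := coneBasis C C'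
  fintype := inferInstance
  bounded := fun j hj => by
    match j, hj with
    | (j + 1), hj =>
      haveI := C.bounded (j + 1) (lt_of_le_of_lt (le_max_left _ _) hj)
      haveI := C'.bounded j (by
        have := lt_of_le_of_lt (le_max_right _ _) hj; omega)
      exact instIsEmptySum
  d := fun j => match j with
    | 0 => Matrix.fromBlocks (C.d 0) 0 (φ.f 0) 0
    | (j + 1) => Matrix.fromBlocks (C.d (j + 1)) 0 (φ.f (j + 1)) (-(C'.d j))
  dd := fun j => by
    match j with
    | 0 =>
      show Matrix.fromBlocks (C.d 1) 0 (φ.f 1) (-(C'.d 0))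
          * Matrix.fromBlocks (C.d 0) 0 (φ.f 0) 0 = 0
      rw [Matrix.fromBlocks_multiply]
      have h1 : C.d 1 * C.d 0 = 0 := C.dd 0
      have h2 : φ.f 1 * C.d 0 = C'.d 0 * φ.f 0 := φ.comm 0
      simp [h1, h2, Matrix.neg_mul, ← Matrix.fromBlocks_zero]
    | (j + 1) =>
      show Matrix.fromBlocks (C.d (j + 2)) 0 (φ.f (j + 2)) (-(C'.d (j + 1)))
          * Matrix.fromBlocks (C.d (j + 1)) 0 (φ.f (j + 1)) (-(C'.d j)) = 0
      rw [Matrix.fromBlocks_multiply]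
      have h1 : C.d (j + 2) * C.d (j + 1) = 0 := C.dd (j + 1)
      have h2 : φ.f (j + 2) * C.d (j + 1) = C'.d (j + 1) * φ.f (j + 1) := φ.comm (j + 1)
      have h3 : C'.d (j + 1) * C'.d j = 0 := C'.dd j
      simp [h1, h2, h3, Matrix.neg_mul, Matrix.mul_neg, ← Matrix.fromBlocks_zero]

namespace L2T

local instance scAdd {ι : Type} [Fintype ι] : AddCommMonoid (Hn Γ ι) :=
  (WithLp.instAddCommGroup 2 (ι → l2 Γ)).toAddCommMonoid

local instance scMod {ι : Type} [Fintype ι] : Module ℂ (Hn Γ ι) :=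
  WithLp.instModule 2 ℂ (ι → l2 Γ)

local instance scTop {ι : Type} [Fintype ι] : TopologicalSpace (Hn Γ ι) :=
  PiLp.topologicalSpace 2 fun _ => l2 Γ


theorem lam_memℓp (γ : Γ) (f : l2 Γ) :
    Memℓp (fun x : Γ => f (γ⁻¹ * x)) (2 : ℝ≥0∞) := by
  have h2 : (0:ℝ) < (2 : ℝ≥0∞).toReal := by norm_num
  apply memℓp_gen
  have hs : Summable fun i : Γ => ‖f i‖ ^ (2 : ℝ≥0∞).toReal := (lp.memℓp f).summable h2
  exact ((Equiv.mulLeft γ⁻¹).summable_iff (f := fun i : Γ => ‖f i‖ ^ (2 : ℝ≥0∞).toReal)).2 hs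

/-- left translation -/
def lam (γ : Γ) : l2 Γ ≃ₗᵢ[ℂ] l2 Γ where
  toFun f := ⟨fun x => f (γ⁻¹ * x), lam_memℓp γ f⟩
  invFun f := ⟨fun x => f (γ * x), by
    have h := lam_memℓp γ⁻¹ f
    rw [inv_inv] at h
    exact h⟩
  left_inv f := by ext x; simp
  right_inv f := by ext x; simp
  map_add' f g := by ext x; rfl
  map_smul' c f := by ext x; simp [lp.coeFn_smul]
  norm_map' f := by
    have h2 : (0:ℝ) < (2 : ℝ≥0∞).toReal := by norm_num
    have h4 : ∑' x : Γ, ‖f (γ⁻¹ * x)‖ ^ (2 : ℝ≥0∞).toReal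
        = ∑' x : Γ, ‖f x‖ ^ (2 : ℝ≥0∞).toReal :=
      (Equiv.mulLeft γ⁻¹).tsum_eq fun x => ‖f x‖ ^ (2 : ℝ≥0∞).toReal
    rw [lp.norm_eq_tsum_rpow h2, lp.norm_eq_tsum_rpow h2, ← h4]
    rfl

@[simp] theorem lam_apply (γ : Γ) (f : l2 Γ) (x : Γ) : (lam γ f) x = f (γ⁻¹ * x) := rfl

@[simp] theorem rho_apply (γ : Γ) (f : l2 Γ) (x : Γ) : (rho γ f) x = f (x * γ) := rfl

/-- left translation on `Hn` -/
def Lt (ι : Type) [Fintype ι] (γ : Γ) : Hn Γ ι →L[ℂ] Hn Γ ι :=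
  ((LinearIsometryEquiv.piLpCongrRight 2 (fun _ : ι => lam γ)).toContinuousLinearEquiv :
    Hn Γ ι ≃L[ℂ] Hn Γ ι).toContinuousLinearMap

theorem Lt_apply {ι : Type} [Fintype ι] (γ : Γ) (f : Hn Γ ι) (i : ι) :
    (Lt ι γ f) i = lam γ (f i) := rfl

theorem lam_one (f : l2 Γ) : lam (1 : Γ) f = f := by ext x; simp
theorem lam_mul (a b : Γ) (f : l2 Γ) : lam a (lam b f) = lam (a * b) f := by
  ext x; simp [mul_assoc]

theorem inner_Lt {ι : Type} [Fintype ι] (γ : Γ) (f g : Hn Γ ι) :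
    inner ℂ (Lt ι γ f) g = inner ℂ f (Lt ι γ⁻¹ g) := by
  have h : Lt ι γ (Lt ι γ⁻¹ g) = g := by
    ext i x
    simp [Lt_apply]
  conv_lhs => rw [← h]
  exact (LinearIsometryEquiv.piLpCongrRight 2 (fun _ : ι => lam γ)).inner_map_map f _

theorem adjoint_Lt {ι : Type} [Fintype ι] (γ : Γ) :
    ContinuousLinearMap.adjoint (Lt ι γ) = Lt ι γ⁻¹ := by
  symm
  rw [ContinuousLinearMap.eq_adjoint_iff]
  intro x y
  rw [inner_Lt, inv_inv]

/-- equivariance -/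
def Eqv {ι κ : Type} [Fintype ι] [Fintype κ] (T : Hn Γ ι →L[ℂ] Hn Γ κ) : Prop :=
  ∀ γ : Γ, T ∘L Lt ι γ = Lt κ γ ∘L T

section
variable {ι κ μ : Type} [Fintype ι] [Fintype κ] [Fintype μ]

theorem Eqv.comp {S : Hn Γ κ →L[ℂ] Hn Γ μ} {T : Hn Γ ι →L[ℂ] Hn Γ κ} (hS : Eqv S) (hT : Eqv T) :
    Eqv (S ∘L T) := by
  intro γ
  rw [ContinuousLinearMap.comp_assoc, hT, ← ContinuousLinearMap.comp_assoc, hS,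
    ContinuousLinearMap.comp_assoc]

theorem Eqv.mul {S T : Hn Γ ι →L[ℂ] Hn Γ ι} (hS : Eqv S) (hT : Eqv T) : Eqv (S * T) :=
  Eqv.comp hS hT

theorem Eqv.add {S T : Hn Γ ι →L[ℂ] Hn Γ κ} (hS : Eqv S) (hT : Eqv T) : Eqv (S + T) := by
  intro γ
  rw [ContinuousLinearMap.add_comp, ContinuousLinearMap.comp_add, hS, hT]

theorem Eqv.neg {S : Hn Γ ι →L[ℂ] Hn Γ κ} (hS : Eqv S) : Eqv (-S) := by
  intro γ
  rw [ContinuousLinearMap.neg_comp, ContinuousLinearMap.comp_neg, hS]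

theorem Eqv.sub {S T : Hn Γ ι →L[ℂ] Hn Γ κ} (hS : Eqv S) (hT : Eqv T) : Eqv (S - T) := by
  rw [sub_eq_add_neg]; exact hS.add hT.neg

theorem Eqv.csmul {S : Hn Γ ι →L[ℂ] Hn Γ κ} (hS : Eqv S) (c : ℂ) : Eqv (c • S) := by
  intro γ
  rw [ContinuousLinearMap.smul_comp, ContinuousLinearMap.comp_smul, hS]

theorem Eqv.smul {S : Hn Γ ι →L[ℂ] Hn Γ κ} (hS : Eqv S) (c : ℝ) : Eqv (c • S) := by
  have : c • S = (c : ℂ) • S := rfl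
  rw [this]; exact hS.csmul _

theorem Eqv.zero : Eqv (0 : Hn Γ ι →L[ℂ] Hn Γ κ) := by
  intro γ
  simp

theorem Eqv.one : Eqv (1 : Hn Γ ι →L[ℂ] Hn Γ ι) := by
  intro γ
  rfl

theorem Eqv.pow {S : Hn Γ ι →L[ℂ] Hn Γ ι} (hS : Eqv S) (n : ℕ) : Eqv (S ^ n) := by
  induction n with
  | zero => rw [pow_zero]; exact Eqv.one
  | succ n ih => rw [pow_succ]; exact ih.mul hS

theorem Eqv.sum {α : Type*} (s : Finset α) {S : α → (Hn Γ ι →L[ℂ] Hn Γ κ)}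
    (hS : ∀ a ∈ s, Eqv (S a)) : Eqv (∑ a ∈ s, S a) := by
  classical
  induction s using Finset.induction_on with
  | empty => simpa using Eqv.zero
  | insert a s ha ih =>
    rw [Finset.sum_insert ha]
    exact (hS a (by simp)).add (ih fun b hb => hS b (by simp [hb]))

theorem Eqv.adjoint {S : Hn Γ ι →L[ℂ] Hn Γ κ} (hS : Eqv S) :
    Eqv (ContinuousLinearMap.adjoint S) := by
  intro γ
  have h := congrArg ContinuousLinearMap.adjoint (hS γ⁻¹)
  rw [ContinuousLinearMap.adjoint_comp, ContinuousLinearMap.adjoint_comp, adjoint_Lt, adjoint_Lt,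
    inv_inv] at h
  exact h.symm

theorem Eqv.inverse {S : Hn Γ ι →L[ℂ] Hn Γ ι} (hS : Eqv S) : Eqv (Ring.inverse S) := by
  by_cases h : IsUnit S
  · intro γ
    have h1 : Commute S (Lt ι γ) := hS γ
    obtain ⟨u, rfl⟩ := h
    rw [Ring.inverse_unit]
    exact (h1.units_inv_left).eq
  · rw [Ring.inverse_non_unit _ h]; exact Eqv.zero

theorem Eqv.aeval {S : Hn Γ ι →L[ℂ] Hn Γ ι} (hS : Eqv S) (p : Polynomial ℝ) :
    Eqv (Polynomial.aeval S p) := by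
  rw [Polynomial.aeval_eq_sum_range]
  exact Eqv.sum _ fun i _ => (hS.pow i).smul _

/-- coefficient -/
theorem deltaE_apply (i : ι) (k : ι) (x : Γ) [Decidable (k = i ∧ x = 1)] :
    (deltaE Γ i : Hn Γ ι) k x = if k = i ∧ x = 1 then 1 else 0 := by
  classical
  unfold deltaE
  by_cases hk : k = i
  · subst hk
    by_cases hx : x = 1
    · subst hx
      simp
    · simp [hx]
  · simp [hk]

theorem inner_deltaE (i : ι) (v : Hn Γ ι) : inner ℂ (deltaE Γ i) v = v i 1 := by
  classical
  unfold deltaE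
  rw [PiLp.inner_apply, Finset.sum_eq_single i]
  · simp [lp.inner_single_left]
  · intro b _ hb
    simp [hb]
  · simp

theorem inner_Lt_deltaE (i : ι) (γ : Γ) (v : Hn Γ ι) :
    inner ℂ (Lt ι γ (deltaE Γ i)) v = v i γ := by
  rw [inner_Lt, inner_deltaE, Lt_apply, lam_apply]
  simp

theorem coef_adjoint {S : Hn Γ ι →L[ℂ] Hn Γ κ} (hS : Eqv S) (i : ι) (k : κ) (γ : Γ) :
    (ContinuousLinearMap.adjoint S (deltaE Γ k)) i γ
      = (starRingEnd ℂ) ((S (deltaE Γ i)) k γ⁻¹) := by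
  rw [← inner_Lt_deltaE, ContinuousLinearMap.adjoint_inner_right, ← inner_conj_symm]
  congr 1
  have h := congrArg (fun T => T (deltaE Γ i)) (hS γ)
  simp only [ContinuousLinearMap.comp_apply] at h
  rw [h, inner_deltaE, Lt_apply, lam_apply, mul_one]

theorem vnTrace_comp {S : Hn Γ κ →L[ℂ] Hn Γ ι} {T : Hn Γ ι →L[ℂ] Hn Γ κ}
    (hS : Eqv S) :
    vnTrace (S ∘L T) = ∑ i, ∑ k, ∑' γ : Γ,
      (starRingEnd ℂ) ((T (deltaE Γ i)) k γ) * (starRingEnd ℂ) ((S (deltaE Γ k)) i γ⁻¹) := by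
  unfold vnTrace
  refine Finset.sum_congr rfl fun i _ => ?_
  rw [ContinuousLinearMap.comp_apply, ← ContinuousLinearMap.adjoint_inner_right,
    PiLp.inner_apply]
  refine Finset.sum_congr rfl fun k _ => ?_
  rw [lp.inner_eq_tsum]
  refine tsum_congr fun γ => ?_
  rw [coef_adjoint hS, RCLike.inner_apply, mul_comm]

theorem vnTrace_comm {S : Hn Γ κ →L[ℂ] Hn Γ ι} {T : Hn Γ ι →L[ℂ] Hn Γ κ}
    (hS : Eqv S) (hT : Eqv T) : vnTrace (S ∘L T) = vnTrace (T ∘L S) := by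
  rw [vnTrace_comp hS, vnTrace_comp hT, Finset.sum_comm]
  refine Finset.sum_congr rfl fun k _ => Finset.sum_congr rfl fun i _ => ?_
  rw [← (Equiv.inv Γ).tsum_eq]
  refine tsum_congr fun γ => ?_
  simp [mul_comm]

/-- real trace -/
def tr (T : Hn Γ ι →L[ℂ] Hn Γ ι) : ℝ := (vnTrace T).re

theorem tr_comm {S : Hn Γ κ →L[ℂ] Hn Γ ι} {T : Hn Γ ι →L[ℂ] Hn Γ κ}
    (hS : Eqv S) (hT : Eqv T) : tr (S ∘L T) = tr (T ∘L S) := by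
  unfold tr; rw [vnTrace_comm hS hT]

theorem tr_add (S T : Hn Γ ι →L[ℂ] Hn Γ ι) : tr (S + T) = tr S + tr T := by
  simp [tr, vnTrace, inner_add_left, Finset.sum_add_distrib]

theorem tr_smul (c : ℝ) (S : Hn Γ ι →L[ℂ] Hn Γ ι) : tr (c • S) = c * tr S := by
  have : c • S = (c : ℂ) • S := rfl
  rw [this]
  simp [tr, vnTrace, inner_smul_left, Finset.mul_sum]

theorem norm_deltaE (i : ι) : ‖(deltaE Γ i : Hn Γ ι)‖ = 1 := by
  classical
  have h := inner_deltaE i (deltaE Γ i : Hn Γ ι)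
  rw [deltaE_apply, inner_self_eq_norm_sq_to_K] at h
  simp at h
  have h2 : ‖(deltaE Γ i : Hn Γ ι)‖ = 1 ∨ ‖(deltaE Γ i : Hn Γ ι)‖ = -1 := by exact_mod_cast h
  rcases h2 with h2 | h2
  · exact h2
  · have := norm_nonneg (deltaE Γ i : Hn Γ ι)
    linarith

theorem abs_tr_le (S : Hn Γ ι →L[ℂ] Hn Γ ι) : |tr S| ≤ Fintype.card ι * ‖S‖ := by
  unfold tr vnTrace
  refine (Complex.abs_re_le_norm _).trans ((norm_sum_le _ _).trans ?_)
  refine (Finset.sum_le_card_nsmul _ _ ‖S‖ fun i _ => ?_).trans (by simp)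
  refine (norm_inner_le_norm _ _).trans ?_
  have := S.le_opNorm (deltaE Γ i)
  rw [norm_deltaE] at *
  simpa using this

/-- trace as a continuous linear map -/
def trL (Γ : Type) [Group Γ] (ι : Type) [Fintype ι] : (Hn Γ ι →L[ℂ] Hn Γ ι) →L[ℝ] ℝ :=
  LinearMap.mkContinuous { toFun := tr, map_add' := tr_add, map_smul' := tr_smul }
    (Fintype.card ι) abs_tr_le

theorem trL_apply (S : Hn Γ ι →L[ℂ] Hn Γ ι) : trL Γ ι S = tr S := rfl

theorem tr_neg (S : Hn Γ ι →L[ℂ] Hn Γ ι) : tr (-S) = -tr S := map_neg (trL Γ ι) S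
theorem tr_sub (S T : Hn Γ ι →L[ℂ] Hn Γ ι) : tr (S - T) = tr S - tr T := map_sub (trL Γ ι) S T
theorem tr_zero : tr (0 : Hn Γ ι →L[ℂ] Hn Γ ι) = 0 := map_zero (trL Γ ι)

theorem tr_adjoint (S : Hn Γ ι →L[ℂ] Hn Γ ι) : tr (ContinuousLinearMap.adjoint S) = tr S := by
  unfold tr vnTrace
  simp only [Complex.re_sum]
  refine Finset.sum_congr rfl fun i _ => ?_
  rw [ContinuousLinearMap.adjoint_inner_left, ← inner_conj_symm, Complex.conj_re]

theorem tr_empty [IsEmpty ι] (S : Hn Γ ι →L[ℂ] Hn Γ ι) : tr S = 0 := by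
  simp [tr, vnTrace]

end

theorem exists_poly {m M : ℝ} (hm : 0 < m) (hM : m ≤ M) : ∃ p : ℕ → Polynomial ℝ,
    (∀ ε > 0, ∀ᶠ n in Filter.atTop, ∀ x ∈ Set.Icc m M, |(p n).eval x - Real.log x| ≤ ε) ∧
    (∀ ε > 0, ∀ᶠ n in Filter.atTop, ∀ x ∈ Set.Icc m M,
      |(Polynomial.derivative (p n)).eval x - x⁻¹| ≤ ε) := by
  have hMp : 0 < M := hm.trans_le hM
  set r : ℝ := 1 - m / M with hr
  have hr0 : 0 ≤ r := by
    rw [hr, sub_nonneg, div_le_one hMp]; exact hM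
  have hr1 : r < 1 := by
    rw [hr]; have : 0 < m / M := by positivity
    linarith
  have hy : ∀ x ∈ Set.Icc m M, 0 ≤ 1 - M⁻¹ * x ∧ 1 - M⁻¹ * x ≤ r := by
    intro x hx
    constructor
    · rw [sub_nonneg, inv_mul_le_iff₀ hMp, mul_one]; exact hx.2
    · rw [hr, div_eq_inv_mul]
      have := mul_le_mul_of_nonneg_left hx.1 (inv_nonneg.2 hMp.le)
      linarith
  refine ⟨fun n => Polynomial.C (Real.log M) - ∑ k ∈ Finset.range n,
    Polynomial.C (((k : ℝ) + 1)⁻¹) * (1 - Polynomial.C M⁻¹ * Polynomial.X) ^ (k + 1), ?_, ?_⟩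
  · intro ε hε
    have ht : Filter.Tendsto (fun n : ℕ => r ^ (n + 1) / (1 - r)) Filter.atTop (nhds 0) := by
      have h1 := (tendsto_pow_atTop_nhds_zero_of_lt_one hr0 hr1).comp (Filter.tendsto_add_atTop_nat 1)
      have := h1.div_const (1 - r)
      simpa using this
    filter_upwards [ht.eventually (gt_mem_nhds hε)] with n hn x hx
    obtain ⟨h0, h1⟩ := hy x hx
    have hxp : 0 < x := hm.trans_le hx.1
    have h2 : |1 - M⁻¹ * x| < 1 := by rw [abs_of_nonneg h0]; linarith
    have h3 := Real.abs_log_sub_add_sum_range_le h2 n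
    rw [sub_sub_cancel, Real.log_mul (inv_ne_zero hMp.ne') hxp.ne', Real.log_inv] at h3
    rw [← abs_neg]
    have h4 : (1 - M⁻¹ * x) ^ (n + 1) / (1 - (1 - M⁻¹ * x)) ≤ r ^ (n + 1) / (1 - r) := by
      have : 0 < 1 - r := by linarith
      gcongr
    rw [abs_of_nonneg h0] at h3
    refine le_trans (le_of_eq ?_) ((h3.trans h4).trans hn.le)
    congr 1
    simp only [Polynomial.eval_sub, Polynomial.eval_C, Polynomial.eval_finset_sum,
      Polynomial.eval_mul, Polynomial.eval_pow, Polynomial.eval_one, Polynomial.eval_X]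
    have : ∀ k : ℕ, (1 - M⁻¹ * x) ^ (k + 1) / ((k : ℝ) + 1)
      = ((k : ℝ) + 1)⁻¹ * (1 - M⁻¹ * x) ^ (k + 1) := fun k => by rw [div_eq_inv_mul]
    simp only [this]
    ring
  · intro ε hε
    have ht : Filter.Tendsto (fun n : ℕ => r ^ n / m) Filter.atTop (nhds 0) := by
      have := (tendsto_pow_atTop_nhds_zero_of_lt_one hr0 hr1).div_const m
      simpa using this
    filter_upwards [ht.eventually (gt_mem_nhds hε)] with n hn x hx
    obtain ⟨h0, h1⟩ := hy x hx
    have hxp : 0 < x := hm.trans_le hx.1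
    have key : (Polynomial.derivative (Polynomial.C (Real.log M) - ∑ k ∈ Finset.range n,
        Polynomial.C (((k : ℝ) + 1)⁻¹) * (1 - Polynomial.C M⁻¹ * Polynomial.X) ^ (k + 1))).eval x
        = M⁻¹ * ∑ k ∈ Finset.range n, (1 - M⁻¹ * x) ^ k := by
      have e : ∀ k : ℕ, (((k : ℝ) + 1)⁻¹ * (((k : ℝ) + 1) * (1 - M⁻¹ * x) ^ k * (0 - M⁻¹)))
          = - (M⁻¹ * (1 - M⁻¹ * x) ^ k) := by
        intro k
        have : (k : ℝ) + 1 ≠ 0 := by positivity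
        field_simp
        ring
      simp only [Polynomial.derivative_sub, Polynomial.derivative_C, Polynomial.derivative_sum,
        Polynomial.derivative_C_mul, Polynomial.derivative_pow_succ, Polynomial.derivative_one,
        Polynomial.derivative_X, Polynomial.eval_sub, Polynomial.eval_zero,
        Polynomial.eval_finset_sum,
        Polynomial.eval_mul, Polynomial.eval_pow, Polynomial.eval_one, Polynomial.eval_X,
        Polynomial.eval_C, Polynomial.eval_add, Polynomial.eval_natCast, mul_one, e, Finset.mul_sum,
        Finset.sum_neg_distrib, zero_sub, neg_neg, Polynomial.eval_neg]
      simp only [mul_neg, zero_sub] at e ⊢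
      simp only [e, Finset.sum_neg_distrib, neg_neg]
    rw [key, geom_sum_eq (by
      have : 0 < M⁻¹ * x := by positivity
      linarith)]
    have e2 : M⁻¹ * (((1 - M⁻¹ * x) ^ n - 1) / (1 - M⁻¹ * x - 1)) - x⁻¹
        = - ((1 - M⁻¹ * x) ^ n / x) := by
      rw [show 1 - M⁻¹ * x - 1 = -(M⁻¹ * x) by ring]
      generalize (1 - M⁻¹ * x) ^ n = z
      field_simp
      ring
    rw [e2, abs_neg, abs_of_nonneg (by positivity)]
    refine le_trans ?_ hn.le
    have := hx.1
    gcongr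

section
variable {ι κ μ : Type} [Fintype ι] [Fintype κ] [Fintype μ]

theorem aeval_close {A : Hn Γ ι →L[ℂ] Hn Γ ι} (hA : IsSelfAdjoint A) (f : ℝ → ℝ)
    (hf : ContinuousOn f (spectrum ℝ A)) (p : Polynomial ℝ) {ε : ℝ} (hε : 0 ≤ ε)
    (h : ∀ x ∈ spectrum ℝ A, |p.eval x - f x| ≤ ε) :
    ‖Polynomial.aeval A p - cfc f A‖ ≤ ε := by
  rw [← cfc_polynomial p A hA, ← cfc_sub (fun x => p.eval x) f A (by fun_prop) hf]
  exact norm_cfc_le hε h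

theorem spec_bounds {A : Hn Γ ι →L[ℂ] Hn Γ ι} (hA0 : 0 ≤ A) (hu : IsUnit A) {m M : ℝ}
    (hm : 0 < m) (h1 : ‖A‖ ≤ M) (h2 : ‖Ring.inverse A‖ ≤ m⁻¹) :
    spectrum ℝ A ⊆ Set.Icc m M := by
  intro x hx
  rcases isEmpty_or_nonempty ι with hι | hι
  · exfalso
    have : Subsingleton (Hn Γ ι →L[ℂ] Hn Γ ι) := by
      refine ⟨fun S T => ?_⟩
      ext v i
      exact hι.elim i
    rw [spectrum.of_subsingleton] at hx
    exact hx
  have : Nontrivial (Hn Γ ι →L[ℂ] Hn Γ ι) := by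
    obtain ⟨i⟩ := hι
    refine ⟨⟨1, 0, fun h => ?_⟩⟩
    have h3 := congrArg (fun T => ‖T (deltaE Γ i)‖) h
    simp [norm_deltaE] at h3
  have hx0 : 0 ≤ x := spectrum_nonneg_of_nonneg hA0 hx
  obtain ⟨u, rfl⟩ := hu
  have hx1 : x ≠ 0 := fun h => spectrum.ne_zero_of_mem_of_unit hx h
  have hxp : 0 < x := lt_of_le_of_ne hx0 hx1.symm
  refine ⟨?_, ?_⟩
  · have h3 : x⁻¹ ∈ spectrum ℝ ((u⁻¹ : (Hn Γ ι →L[ℂ] Hn Γ ι)ˣ) : Hn Γ ι →L[ℂ] Hn Γ ι) := by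
      have := (spectrum.inv_mem_iff (r := (Units.mk0 x hx1)) (a := u)).1 hx
      simpa using this
    have h4 := spectrum.norm_le_norm_of_mem h3
    rw [Ring.inverse_unit] at h2
    rw [Real.norm_of_nonneg (by positivity)] at h4
    exact (inv_le_inv₀ hxp hm).1 (h4.trans h2)
  · have h4 := spectrum.norm_le_norm_of_mem hx
    rw [Real.norm_of_nonneg hx0] at h4
    exact h4.trans h1

theorem hasDerivAt_pow_tr {A : ℝ → (Hn Γ ι →L[ℂ] Hn Γ ι)} {A' : Hn Γ ι →L[ℂ] Hn Γ ι} {t : ℝ}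
    (hA : HasDerivAt A A' t) (he : Eqv (A t)) (he' : Eqv A') (n : ℕ) :
    ∃ D : Hn Γ ι →L[ℂ] Hn Γ ι, HasDerivAt (fun s => A s ^ n) D t ∧ Eqv D ∧
      ∀ B : Hn Γ ι →L[ℂ] Hn Γ ι, Eqv B → Commute B (A t) →
        tr (B * D) = n * tr (B * A t ^ (n - 1) * A') := by
  induction n with
  | zero =>
    refine ⟨0, ?_, Eqv.zero, fun B _ _ => ?_⟩
    · simpa using hasDerivAt_const t (1 : Hn Γ ι →L[ℂ] Hn Γ ι)
    · rw [mul_zero, tr_zero]; simp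
  | succ n ih =>
    obtain ⟨D, hD, hDe, hDB⟩ := ih
    refine ⟨D * A t + A t ^ n * A', ?_, (hDe.mul he).add ((he.pow n).mul he'), fun B hB hc => ?_⟩
    · simp only [pow_succ]
      exact hD.mul hA
    · rw [mul_add, tr_add]
      have h1 : tr (B * (D * A t)) = tr ((B * A t) * D) := by
        rw [← mul_assoc]
        have := tr_comm (hB.mul hDe) he
        rw [hc.eq, mul_assoc]
        exact this
      rw [h1, hDB _ (hB.mul he) (hc.mul_left (Commute.refl _))]
      rcases n with _ | n
      · simp [mul_assoc]
      · simp only [Nat.add_sub_cancel]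
        rw [mul_assoc B (A t), ← pow_succ', mul_assoc B]
        push_cast
        ring

theorem hasDerivAt_aeval_tr {A : ℝ → (Hn Γ ι →L[ℂ] Hn Γ ι)} {A' : Hn Γ ι →L[ℂ] Hn Γ ι} {t : ℝ}
    (hA : HasDerivAt A A' t) (he : Eqv (A t)) (he' : Eqv A') (p : Polynomial ℝ) :
    HasDerivAt (fun s => tr (Polynomial.aeval (A s) p))
      (tr (Polynomial.aeval (A t) (Polynomial.derivative p) * A')) t := by
  induction p using Polynomial.induction_on' with
  | add p q hp hq =>
    simp only [map_add, tr_add, add_mul]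
    exact hp.add hq
  | monomial n a =>
    obtain ⟨D, hD, hDe, hDB⟩ := hasDerivAt_pow_tr hA he he' n
    have h1 := hDB 1 Eqv.one (Commute.one_left _)
    rw [one_mul, one_mul] at h1
    have h2 : HasDerivAt (fun s => tr (A s ^ n)) (tr D) t :=
      (trL Γ ι).hasFDerivAt.comp_hasDerivAt t hD
    simp only [Polynomial.derivative_monomial, Polynomial.aeval_monomial,
      ← Algebra.smul_def, tr_smul, smul_mul_assoc]
    rw [mul_assoc, ← h1]
    exact h2.const_mul a

/-- log-determinant of `star T * T` -/
def ld (T : Hn Γ ι →L[ℂ] Hn Γ ι) : ℝ := tr (cfc Real.log (star T * T))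

theorem isUnit_sq {T : Hn Γ ι →L[ℂ] Hn Γ ι} (hT : IsUnit T) : IsUnit (star T * T) :=
  hT.star.mul hT

theorem hasDerivAt_ld {Δ Δ' : ℝ → (Hn Γ ι →L[ℂ] Hn Γ ι)}
    (hd : ∀ t, HasDerivAt Δ (Δ' t) t) (hsa : ∀ t, IsSelfAdjoint (Δ t)) (hsa' : ∀ t, IsSelfAdjoint (Δ' t))
    (hu : ∀ t, IsUnit (Δ t)) (he : ∀ t, Eqv (Δ t)) (he' : ∀ t, Eqv (Δ' t)) (hc : Continuous Δ')
    (t : ℝ) :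
    HasDerivAt (fun s => ld (Δ s)) (2 * tr (Ring.inverse (Δ t) * Δ' t)) t := by
  have hcΔ : Continuous Δ := continuous_iff_continuousAt.2 fun t => (hd t).continuousAt
  set A : ℝ → (Hn Γ ι →L[ℂ] Hn Γ ι) := fun t => star (Δ t) * Δ t with hA
  set A' : ℝ → (Hn Γ ι →L[ℂ] Hn Γ ι) := fun t => Δ' t * Δ t + Δ t * Δ' t with hA'
  have hAsq : A = fun t => Δ t * Δ t := by
    funext t; rw [hA]; simp only; rw [(hsa t).star_eq]
  have hAd : ∀ t, HasDerivAt A (A' t) t := by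
    intro t
    rw [hAsq]
    exact (hd t).mul (hd t)
  have hAc : Continuous A := continuous_iff_continuousAt.2 fun t => (hAd t).continuousAt
  have hA'c : Continuous A' := by
    rw [hA']; fun_prop
  have hAe : ∀ t, Eqv (A t) := fun t => by rw [hAsq]; exact (he t).mul (he t)
  have hA'e : ∀ t, Eqv (A' t) := fun t => ((he' t).mul (he t)).add ((he t).mul (he' t))
  have hAu : ∀ t, IsUnit (A t) := fun t => isUnit_sq (hu t)
  have hApos : ∀ t, 0 ≤ A t := fun t => star_mul_self_nonneg _
  have hAsa : ∀ t, IsSelfAdjoint (A t) := fun t => IsSelfAdjoint.star_mul_self _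
  have hinvc : ContinuousAt (fun s => Ring.inverse (A s)) t := by
    obtain ⟨u, hu⟩ := hAu t
    have := NormedRing.inverse_continuousAt u
    rw [hu] at this
    exact ContinuousAt.comp this hAc.continuousAt
  -- derivative value
  have hval : 2 * tr (Ring.inverse (Δ t) * Δ' t) = tr (Ring.inverse (A t) * A' t) := by
    have hi : Ring.inverse (A t) = Ring.inverse (Δ t) * Ring.inverse (Δ t) := by
      rw [hAsq]
      exact Ring.mul_inverse_rev' (Commute.refl _)
    have hg := (he t).inverse
    have h1 : Ring.inverse (Δ t) * Δ t = 1 := Ring.inverse_mul_cancel _ (hu t)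
    have h2 : Δ t * Ring.inverse (Δ t) = 1 := Ring.mul_inverse_cancel _ (hu t)
    rw [hi, hA', mul_add, tr_add]
    have e1 : tr (Ring.inverse (Δ t) * Ring.inverse (Δ t) * (Δ' t * Δ t))
        = tr (Ring.inverse (Δ t) * Δ' t) := by
      rw [← mul_assoc]
      refine (tr_comm ((hg.mul hg).mul (he' t)) (he t)).trans ?_
      change tr (Δ t * (Ring.inverse (Δ t) * Ring.inverse (Δ t) * Δ' t)) = _
      rw [← mul_assoc, ← mul_assoc, h2, one_mul]
    have e2 : Ring.inverse (Δ t) * Ring.inverse (Δ t) * (Δ t * Δ' t)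
        = Ring.inverse (Δ t) * Δ' t := by
      rw [mul_assoc, ← mul_assoc _ (Δ t), h1, one_mul]
    rw [e1, e2]; ring
  rw [hval]
  -- local bounds
  set M : ℝ := max (‖A t‖ + 1) 1
  set R : ℝ := ‖Ring.inverse (A t)‖ + 1
  have hR : 0 < R := by positivity
  have hM1 : 1 ≤ M := le_max_right _ _
  set m : ℝ := min R⁻¹ 1
  have hm : 0 < m := lt_min (by positivity) one_pos
  have hmM : m ≤ M := (min_le_right _ _).trans hM1
  set B : ℝ := ‖A' t‖ + 1
  have ev : ∀ᶠ s in nhds t, ‖A s‖ < M ∧ ‖Ring.inverse (A s)‖ < R ∧ ‖A' s‖ < B := by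
    refine ((hAc.norm.continuousAt).eventually (gt_mem_nhds ?_)).and
      (((hinvc.norm).eventually (gt_mem_nhds ?_)).and
      ((hA'c.norm.continuousAt).eventually (gt_mem_nhds ?_)))
    · exact (lt_add_one _).trans_le (le_max_left _ _)
    · exact lt_add_one _
    · exact lt_add_one _
  obtain ⟨U, hU, hUo, htU⟩ := eventually_nhds_iff.1 ev
  have hspec : ∀ s ∈ U, spectrum ℝ (A s) ⊆ Set.Icc m M := by
    intro s hs
    refine spec_bounds (hApos s) (hAu s) hm (hU s hs).1.le ((hU s hs).2.1.le.trans ?_)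
    rw [← inv_inv R]
    exact (inv_le_inv₀ (by positivity) hm).2 (min_le_left _ _)
  have hcl : ∀ s ∈ U, ContinuousOn Real.log (spectrum ℝ (A s)) := fun s hs x hx =>
    (Real.continuousAt_log (hm.trans_le (hspec s hs hx).1).ne').continuousWithinAt
  have hci : ∀ s ∈ U, ContinuousOn (fun x : ℝ => x⁻¹) (spectrum ℝ (A s)) := fun s hs x hx =>
    (continuousAt_inv₀ (hm.trans_le (hspec s hs hx).1).ne').continuousWithinAt
  have hinv : ∀ s ∈ U, cfc (fun x : ℝ => x⁻¹) (A s) = Ring.inverse (A s) := by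
    intro s hs
    obtain ⟨u, hu⟩ := hAu s
    have hsa := hAsa s
    rw [← hu] at hsa ⊢
    rw [Ring.inverse_unit]
    exact cfc_inv_id u
  obtain ⟨p, hp1, hp2⟩ := exists_poly hm hmM
  refine hasDerivAt_of_tendstoUniformlyOn (l := Filter.atTop) hUo
    (f := fun n s => tr (Polynomial.aeval (A s) (p n)))
    (f' := fun n s => tr (Polynomial.aeval (A s) (Polynomial.derivative (p n)) * A' s))
    (g' := fun s => tr (Ring.inverse (A s) * A' s))
    ?_ ?_ ?_ htU
  · rw [Metric.tendstoUniformlyOn_iff]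
    intro ε hε
    set K : ℝ := Fintype.card ι * B + 1
    have hK : 0 < K := by positivity
    filter_upwards [hp2 (ε / K) (by positivity)] with n hn s hs
    rw [dist_comm, Real.dist_eq, ← tr_sub, ← sub_mul, ← hinv s hs]
    have h1 := aeval_close (hAsa s) _ (hci s hs) (Polynomial.derivative (p n))
      (ε := ε / K) (by positivity) (fun x hx => hn x (hspec s hs hx))
    refine (abs_tr_le _).trans_lt ?_
    have h2 := (norm_mul_le (Polynomial.aeval (A s) (Polynomial.derivative (p n))
      - cfc (fun x : ℝ => x⁻¹) (A s)) (A' s)).trans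
      (mul_le_mul h1 (hU s hs).2.2.le (norm_nonneg _) (by positivity))
    calc _ ≤ (Fintype.card ι : ℝ) * (ε / K * B) := by gcongr
      _ = ε / K * (Fintype.card ι * B) := by ring
      _ < ε / K * K := by
        have : (Fintype.card ι : ℝ) * B < K := lt_add_one _
        have : 0 < ε / K := by positivity
        gcongr
      _ = ε := by field_simp
  · exact Filter.Eventually.of_forall fun n s hs =>
      hasDerivAt_aeval_tr (hAd s) (hAe s) (hA'e s) (p n)
  · intro s hs
    have : Filter.Tendsto (fun n => Polynomial.aeval (A s) (p n)) Filter.atTop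
        (nhds (cfc Real.log (A s))) := by
      rw [Metric.tendsto_atTop']
      intro ε hε
      obtain ⟨N, hN⟩ := Filter.eventually_atTop.1 (hp1 (ε / 2) (by positivity))
      refine ⟨N, fun n hn => ?_⟩
      rw [dist_eq_norm]
      refine (aeval_close (hAsa s) _ (hcl s hs) (p n) (by positivity)
        (fun x hx => hN n hn.le x (hspec s hs hx))).trans_lt (by linarith)
    exact ((trL Γ ι).continuous.tendsto _).comp this

/-- intertwining -/
theorem aeval_intertwine {A : Hn Γ ι →L[ℂ] Hn Γ ι} {B : Hn Γ κ →L[ℂ] Hn Γ κ}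
    {V : Hn Γ ι →L[ℂ] Hn Γ κ} (h : V ∘L A = B ∘L V) (p : Polynomial ℝ) :
    V ∘L Polynomial.aeval A p = Polynomial.aeval B p ∘L V := by
  have hp : ∀ n : ℕ, V ∘L (A ^ n) = (B ^ n) ∘L V := by
    intro n
    induction n with
    | zero => ext1 x; simp
    | succ n ih =>
      rw [pow_succ, pow_succ, ContinuousLinearMap.mul_def, ContinuousLinearMap.mul_def,
        ← ContinuousLinearMap.comp_assoc, ih, ContinuousLinearMap.comp_assoc, h,
        ContinuousLinearMap.comp_assoc]
  induction p using Polynomial.induction_on' with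
  | add p q hp hq =>
    rw [map_add, map_add, ContinuousLinearMap.comp_add, ContinuousLinearMap.add_comp, hp, hq]
  | monomial n a =>
    rw [Polynomial.aeval_monomial, Polynomial.aeval_monomial, ← Algebra.smul_def,
      ← Algebra.smul_def]
    have e1 : V ∘L (a • A ^ n) = a • (V ∘L (A ^ n)) := by ext1 x; simp
    have e2 : (a • B ^ n) ∘L V = a • ((B ^ n) ∘L V) := by ext1 x; simp
    rw [e1, e2, hp]

theorem exists_bounds {T : Hn Γ ι →L[ℂ] Hn Γ ι} (hT : IsUnit T) :
    ∃ m₀ M₀ : ℝ, 0 < m₀ ∧ ∀ m M, 0 < m → m ≤ m₀ → M₀ ≤ M → 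
      spectrum ℝ (star T * T) ⊆ Set.Icc m M := by
  refine ⟨(‖Ring.inverse (star T * T)‖ + 1)⁻¹, ‖star T * T‖, by positivity,
    fun m M hm h1 h2 => ?_⟩
  refine spec_bounds (star_mul_self_nonneg _) (isUnit_sq hT) hm h2 ?_
  have := (le_inv_comm₀ hm (by positivity)).1 h1
  exact (lt_add_one _).le.trans this

/-- common polynomial approximation of log -/
theorem ld_approx {m M : ℝ} (hm : 0 < m) {p : ℕ → Polynomial ℝ}
    (hp : ∀ ε > 0, ∀ᶠ n in Filter.atTop, ∀ x ∈ Set.Icc m M, |(p n).eval x - Real.log x| ≤ ε)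
    {T : Hn Γ ι →L[ℂ] Hn Γ ι} (hs : spectrum ℝ (star T * T) ⊆ Set.Icc m M) :
    Filter.Tendsto (fun n => tr (Polynomial.aeval (star T * T) (p n))) Filter.atTop
      (nhds (ld T)) := by
  have hcl : ContinuousOn Real.log (spectrum ℝ (star T * T)) := fun x hx =>
    (Real.continuousAt_log (hm.trans_le (hs hx).1).ne').continuousWithinAt
  have : Filter.Tendsto (fun n => Polynomial.aeval (star T * T) (p n)) Filter.atTop
      (nhds (cfc Real.log (star T * T))) := by
    rw [Metric.tendsto_atTop']
    intro ε hε
    obtain ⟨N, hN⟩ := Filter.eventually_atTop.1 (hp (ε / 2) (by positivity))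
    refine ⟨N, fun n hn => ?_⟩
    rw [dist_eq_norm]
    refine (aeval_close (IsSelfAdjoint.star_mul_self T) _ hcl (p n) (by positivity)
      (fun x hx => hN n hn.le x (hs hx))).trans_lt (by linarith)
  exact ((trL Γ ι).continuous.tendsto _).comp this

end

open ContinuousLinearMap in
theorem coercive_unit {E E1 E2 : Type} [NormedAddCommGroup E] [InnerProductSpace ℂ E]
    [CompleteSpace E] [NormedAddCommGroup E1] [InnerProductSpace ℂ E1]
    [CompleteSpace E1] [NormedAddCommGroup E2] [InnerProductSpace ℂ E2]
    [CompleteSpace E2] (a : E →L[ℂ] E1) (b : E2 →L[ℂ] E) (h : E1 →L[ℂ] E) (g : E →L[ℂ] E2)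
    (hh : h ∘L a + b ∘L g = 1) : IsUnit (adjoint a ∘L a + b ∘L adjoint b) := by
  set c : ℝ := ‖h‖ + ‖g‖ + 1 with hc
  have hcp : 0 < c := by positivity
  have hbd : ∀ x, ‖x‖ ≤ c * (‖a x‖ + ‖adjoint b x‖) := by
    intro x
    have h1 : h (a x) + b (g x) = x := by
      have := congrArg (fun T => T x) hh
      simpa using this
    have h2 : ‖x‖ * ‖x‖ ≤ (c * (‖a x‖ + ‖adjoint b x‖)) * ‖x‖ := by
      calc ‖x‖ * ‖x‖ = ‖inner ℂ x x‖ := by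
            rw [inner_self_eq_norm_sq_to_K]; simp [sq]
        _ = ‖inner ℂ (h (a x)) x + inner ℂ (g x) (adjoint b x)‖ := by
            rw [adjoint_inner_right, ← inner_add_left, h1]
        _ ≤ ‖h (a x)‖ * ‖x‖ + ‖g x‖ * ‖adjoint b x‖ :=
            (norm_add_le _ _).trans (add_le_add (norm_inner_le_norm _ _) (norm_inner_le_norm _ _))
        _ ≤ (‖h‖ * ‖a x‖) * ‖x‖ + (‖g‖ * ‖x‖) * ‖adjoint b x‖ := by
            gcongr
            · exact h.le_opNorm _
            · exact g.le_opNorm _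
        _ ≤ (c * ‖a x‖) * ‖x‖ + (c * ‖x‖) * ‖adjoint b x‖ := by
            have := norm_nonneg h
            have := norm_nonneg g
            gcongr <;> linarith
        _ = _ := by ring
    rcases (norm_nonneg x).eq_or_lt with h0 | h0
    · rw [← h0]; positivity
    · exact le_of_mul_le_mul_right h2 h0
  refine isUnit_of_forall_le_norm_inner_map _ (c := Real.toNNReal (2 * c ^ 2)⁻¹)
    (Real.toNNReal_pos.2 (by positivity)) fun x => ?_
  rw [Real.coe_toNNReal _ (by positivity)]
  have h3 : inner ℂ ((adjoint a ∘L a + b ∘L adjoint b) x) x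
      = ((‖a x‖ ^ 2 + ‖adjoint b x‖ ^ 2 : ℝ) : ℂ) := by
    simp only [add_apply, comp_apply, inner_add_left]
    rw [adjoint_inner_left, ← adjoint_inner_right b, inner_self_eq_norm_sq_to_K,
      inner_self_eq_norm_sq_to_K]
    push_cast
    rfl
  rw [h3, Complex.norm_real, Real.norm_of_nonneg (by positivity), mul_inv_le_iff₀ (by positivity)]
  have h4 := hbd x
  calc ‖x‖ ^ 2 ≤ (c * (‖a x‖ + ‖adjoint b x‖)) ^ 2 := by gcongr
    _ ≤ _ := by
      nlinarith [mul_nonneg (sq_nonneg c) (sq_nonneg (‖a x‖ - ‖adjoint b x‖))]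

section
variable {ι κ μ : Type} [Fintype ι] [Fintype κ] [Fintype μ]

theorem inverse_intertwine {A : Hn Γ ι →L[ℂ] Hn Γ ι} {B : Hn Γ κ →L[ℂ] Hn Γ κ}
    {V : Hn Γ ι →L[ℂ] Hn Γ κ} (h : V ∘L A = B ∘L V) (hA : IsUnit A) (hB : IsUnit B) :
    V ∘L Ring.inverse A = Ring.inverse B ∘L V := by
  have h1 : A ∘L Ring.inverse A = 1 := Ring.mul_inverse_cancel _ hA
  have h2 : Ring.inverse B ∘L B = 1 := Ring.inverse_mul_cancel _ hB
  calc V ∘L Ring.inverse A = (Ring.inverse B ∘L B) ∘L (V ∘L Ring.inverse A) := by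
        rw [h2]; rfl
    _ = Ring.inverse B ∘L ((B ∘L V) ∘L Ring.inverse A) := by
        simp only [ContinuousLinearMap.comp_assoc]
    _ = Ring.inverse B ∘L (V ∘L (A ∘L Ring.inverse A)) := by
        rw [← h]; simp only [ContinuousLinearMap.comp_assoc]
    _ = _ := by rw [h1]; rfl

theorem hasDerivAt_bilin (a b : Hn Γ κ →L[ℂ] Hn Γ μ) (c e : Hn Γ ι →L[ℂ] Hn Γ κ) (t : ℝ) :
    HasDerivAt (fun s : ℝ => (a + s • b) ∘L (c + s • e))
      (b ∘L (c + t • e) + (a + t • b) ∘L e) t := by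
  have h1 : (fun s : ℝ => (a + s • b) ∘L (c + s • e)) =
      fun s : ℝ => a ∘L c + (s • (b ∘L c + a ∘L e) + (s * s) • (b ∘L e)) := by
    funext s
    ext1 x
    simp [mul_smul, smul_add]
    abel
  rw [h1]
  have h2 : b ∘L (c + t • e) + (a + t • b) ∘L e
      = (1 : ℝ) • (b ∘L c + a ∘L e) + (1 * t + t * 1) • (b ∘L e) := by
    ext1 x
    simp [add_smul]
    abel
  rw [h2]
  exact (((hasDerivAt_id t).smul_const _).add
    (((hasDerivAt_id t).mul (hasDerivAt_id t)).smul_const _)).const_add _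

theorem adjoint_affine (a b : Hn Γ κ →L[ℂ] Hn Γ μ) (t : ℝ) :
    ContinuousLinearMap.adjoint (a + t • b)
      = ContinuousLinearMap.adjoint a + t • ContinuousLinearMap.adjoint b := by
  have h1 : t • b = (t : ℂ) • b := rfl
  have h2 : t • ContinuousLinearMap.adjoint b = (t : ℂ) • ContinuousLinearMap.adjoint b := rfl
  rw [h1, h2, map_add, map_smulₛₗ]
  simp

theorem eventually_spec {T : Hn Γ ι →L[ℂ] Hn Γ ι} (hT : IsUnit T) :
    ∀ᶠ R : ℝ in Filter.atTop, spectrum ℝ (star T * T) ⊆ Set.Icc R⁻¹ R := by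
  obtain ⟨m₀, M₀, hm₀, h⟩ := exists_bounds hT
  filter_upwards [Filter.eventually_ge_atTop m₀⁻¹, Filter.eventually_ge_atTop M₀,
    Filter.eventually_gt_atTop 0] with R h1 h2 h3
  exact h _ _ (by positivity) (inv_le_of_inv_le₀ hm₀ h1) h2

theorem exists_poly' {R : ℝ} (hR : 1 ≤ R) : ∃ p : ℕ → Polynomial ℝ,
    (∀ ε > 0, ∀ᶠ n in Filter.atTop, ∀ x ∈ Set.Icc R⁻¹ R, |(p n).eval x - Real.log x| ≤ ε) := by
  obtain ⟨p, hp, -⟩ := exists_poly (m := R⁻¹) (M := R) (by positivity)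
    ((inv_le_one_of_one_le₀ hR).trans hR)
  exact ⟨p, hp⟩

/-- block sums -/
theorem ld_block {V : Hn Γ ι →L[ℂ] Hn Γ μ} {W : Hn Γ κ →L[ℂ] Hn Γ μ}
    {V' : Hn Γ μ →L[ℂ] Hn Γ ι} {W' : Hn Γ μ →L[ℂ] Hn Γ κ}
    (hVe : Eqv V) (hWe : Eqv W) (hVe' : Eqv V') (hWe' : Eqv W')
    (hV : V' ∘L V = 1) (hW : W' ∘L W = 1) (hVW : V ∘L V' + W ∘L W' = 1)
    {A : Hn Γ ι →L[ℂ] Hn Γ ι} {B : Hn Γ κ →L[ℂ] Hn Γ κ} {T : Hn Γ μ →L[ℂ] Hn Γ μ}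
    (hAe : Eqv A) (hBe : Eqv B) (hTe : Eqv T)
    (hA : IsUnit A) (hB : IsUnit B) (hT : IsUnit T) (hAs : IsSelfAdjoint A)
    (hBs : IsSelfAdjoint B) (hTs : IsSelfAdjoint T)
    (h1 : V ∘L A = T ∘L V) (h2 : W ∘L B = T ∘L W) : ld T = ld A + ld B := by
  obtain ⟨R, ⟨⟨hRA, hRB⟩, hRT⟩, hR⟩ := (((eventually_spec hA).and (eventually_spec hB)).and
    (eventually_spec hT)).and (Filter.eventually_ge_atTop 1) |>.exists
  obtain ⟨p, hp⟩ := exists_poly' hR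
  have hRp : 0 < R⁻¹ := by positivity
  have tA := ld_approx hRp hp hRA
  have tB := ld_approx hRp hp hRB
  have tT := ld_approx hRp hp hRT
  refine tendsto_nhds_unique tT ((tA.add tB).congr fun n => ?_)
  have key : ∀ {ν : Type} [Fintype ν] {Z : Hn Γ ν →L[ℂ] Hn Γ μ} {Z' : Hn Γ μ →L[ℂ] Hn Γ ν}
      {D : Hn Γ ν →L[ℂ] Hn Γ ν}, Eqv Z → Eqv Z' → Eqv D → IsSelfAdjoint D → Z' ∘L Z = 1 →
      Z ∘L D = T ∘L Z → tr (Polynomial.aeval (star D * D) (p n))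
        = tr (Polynomial.aeval (star T * T) (p n) ∘L (Z ∘L Z')) := by
    intro ν _ Z Z' D hZ hZ' hD hDs hZZ hZD
    rw [hDs.star_eq, hTs.star_eq]
    have e1 : Z ∘L (D * D) = (T * T) ∘L Z := by
      rw [ContinuousLinearMap.mul_def, ContinuousLinearMap.mul_def,
        ← ContinuousLinearMap.comp_assoc, hZD, ContinuousLinearMap.comp_assoc, hZD,
        ContinuousLinearMap.comp_assoc]
    have e2 := aeval_intertwine e1 (p n)
    rw [← ContinuousLinearMap.comp_assoc, ← e2]
    have hp := (hD.mul hD).aeval (p n)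
    rw [tr_comm (hZ.comp hp) hZ', ← ContinuousLinearMap.comp_assoc, hZZ]
    rfl
  rw [key hVe hVe' hAe hAs hV h1, key hWe hWe' hBe hBs hW h2, ← tr_add,
    ← ContinuousLinearMap.comp_add, hVW]
  rfl

end

section complexes
variable {ι : ℕ → Type} [∀ j, Fintype (ι j)]

/-- `d* d` -/
def PP (d : ∀ j, Hn Γ (ι j) →L[ℂ] Hn Γ (ι (j + 1))) (j : ℕ) : Hn Γ (ι j) →L[ℂ] Hn Γ (ι j) :=
  ContinuousLinearMap.adjoint (d j) ∘L d j

/-- `d d*` -/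
def QQ (d : ∀ j, Hn Γ (ι j) →L[ℂ] Hn Γ (ι (j + 1))) : (j : ℕ) → Hn Γ (ι j) →L[ℂ] Hn Γ (ι j)
  | 0 => 0
  | j + 1 => d j ∘L ContinuousLinearMap.adjoint (d j)

/-- Laplacian -/
def lapl (d : ∀ j, Hn Γ (ι j) →L[ℂ] Hn Γ (ι (j + 1))) (j : ℕ) : Hn Γ (ι j) →L[ℂ] Hn Γ (ι j) :=
  PP d j + QQ d j

theorem sa_PP (d : ∀ j, Hn Γ (ι j) →L[ℂ] Hn Γ (ι (j + 1))) (j : ℕ) :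
    ContinuousLinearMap.adjoint (PP d j) = PP d j := by
  unfold PP
  rw [ContinuousLinearMap.adjoint_comp, ContinuousLinearMap.adjoint_adjoint]

theorem sa_QQ (d : ∀ j, Hn Γ (ι j) →L[ℂ] Hn Γ (ι (j + 1))) (j : ℕ) :
    ContinuousLinearMap.adjoint (QQ d j) = QQ d j := by
  cases j with
  | zero => exact map_zero _
  | succ j =>
    unfold QQ
    rw [ContinuousLinearMap.adjoint_comp, ContinuousLinearMap.adjoint_adjoint]

theorem sa_lapl' (d : ∀ j, Hn Γ (ι j) →L[ℂ] Hn Γ (ι (j + 1))) (j : ℕ) :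
    ContinuousLinearMap.adjoint (lapl d j) = lapl d j := by
  unfold lapl
  rw [map_add, sa_PP, sa_QQ]

theorem sa_lapl (d : ∀ j, Hn Γ (ι j) →L[ℂ] Hn Γ (ι (j + 1))) (j : ℕ) :
    IsSelfAdjoint (lapl d j) := sa_lapl' d j

variable {d : ∀ j, Hn Γ (ι j) →L[ℂ] Hn Γ (ι (j + 1))}

theorem eqv_PP (he : ∀ j, Eqv (d j)) (j : ℕ) : Eqv (PP d j) := (he j).adjoint.comp (he j)

theorem eqv_QQ (he : ∀ j, Eqv (d j)) (j : ℕ) : Eqv (QQ d j) := by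
  cases j with
  | zero => exact Eqv.zero
  | succ j => exact (he j).comp (he j).adjoint

theorem eqv_lapl (he : ∀ j, Eqv (d j)) (j : ℕ) : Eqv (lapl d j) := (eqv_PP he j).add (eqv_QQ he j)

theorem lapl_comm (hdd : ∀ j, d (j + 1) ∘L d j = 0) (j : ℕ) :
    d j ∘L lapl d j = lapl d (j + 1) ∘L d j := by
  have h1 : d j ∘L QQ d j = 0 := by
    cases j with
    | zero => exact ContinuousLinearMap.comp_zero _
    | succ j =>
      unfold QQ
      rw [← ContinuousLinearMap.comp_assoc, hdd, ContinuousLinearMap.zero_comp]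
  have h2 : PP d (j + 1) ∘L d j = 0 := by
    unfold PP
    rw [ContinuousLinearMap.comp_assoc, hdd, ContinuousLinearMap.comp_zero]
  unfold lapl
  rw [ContinuousLinearMap.comp_add, h1, ContinuousLinearMap.add_comp, h2, add_zero, zero_add]
  rfl

theorem G_comm (hdd : ∀ j, d (j + 1) ∘L d j = 0) (hu : ∀ j, IsUnit (lapl d j)) (j : ℕ) :
    d j ∘L Ring.inverse (lapl d j) = Ring.inverse (lapl d (j + 1)) ∘L d j :=
  inverse_intertwine (lapl_comm hdd j) (hu j) (hu (j + 1))

theorem G_comm' (hdd : ∀ j, d (j + 1) ∘L d j = 0) (hu : ∀ j, IsUnit (lapl d j)) (j : ℕ) :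
    ContinuousLinearMap.adjoint (d j) ∘L Ring.inverse (lapl d (j + 1))
      = Ring.inverse (lapl d j) ∘L ContinuousLinearMap.adjoint (d j) := by
  refine inverse_intertwine ?_ (hu (j + 1)) (hu j)
  have h := congrArg ContinuousLinearMap.adjoint (lapl_comm hdd j)
  rw [ContinuousLinearMap.adjoint_comp, ContinuousLinearMap.adjoint_comp, sa_lapl', sa_lapl'] at h
  exact h.symm

theorem sa_G (hu : ∀ j, IsUnit (lapl d j)) (j : ℕ) :
    ContinuousLinearMap.adjoint (Ring.inverse (lapl d j)) = Ring.inverse (lapl d j) := by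
  have h := sa_lapl d j
  obtain ⟨u, hu⟩ := hu j
  rw [← hu] at h ⊢
  rw [Ring.inverse_unit]
  have h2 : star u = u := Units.ext h
  change star ((u⁻¹ : (Hn Γ (ι j) →L[ℂ] Hn Γ (ι j))ˣ) : Hn Γ (ι j) →L[ℂ] Hn Γ (ι j)) = _
  rw [← Units.coe_star, star_inv, h2]

theorem alt_sum (hdd : ∀ j, d (j + 1) ∘L d j = 0) (hu : ∀ j, IsUnit (lapl d j))
    (he : ∀ j, Eqv (d j)) {X : ∀ j, Hn Γ (ι j) →L[ℂ] Hn Γ (ι j)} (hX : ∀ j, Eqv (X j))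
    (hXd : ∀ j, d j ∘L X j = X (j + 1) ∘L d j) (M : ℕ) :
    ∑ j ∈ Finset.range (M + 1), (-1 : ℝ) ^ j * tr (X j)
      = (-1) ^ M * tr (X M ∘L Ring.inverse (lapl d M) ∘L PP d M) := by
  have hG : ∀ j, Eqv (Ring.inverse (lapl d j)) := fun j => (eqv_lapl he j).inverse
  have h0 : ∀ j, tr (X j) = tr (X j ∘L Ring.inverse (lapl d j) ∘L PP d j)
      + tr (X j ∘L Ring.inverse (lapl d j) ∘L QQ d j) := by
    intro j
    rw [← tr_add, ← ContinuousLinearMap.comp_add, ← ContinuousLinearMap.comp_add]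
    have : Ring.inverse (lapl d j) ∘L (PP d j + QQ d j) = 1 :=
      Ring.inverse_mul_cancel _ (hu j)
    rw [this]
    rfl
  have h1 : ∀ j, tr (X (j + 1) ∘L Ring.inverse (lapl d (j + 1)) ∘L QQ d (j + 1))
      = tr (X j ∘L Ring.inverse (lapl d j) ∘L PP d j) := by
    intro j
    have : X (j + 1) ∘L Ring.inverse (lapl d (j + 1)) ∘L QQ d (j + 1)
        = d j ∘L (X j ∘L Ring.inverse (lapl d j) ∘L ContinuousLinearMap.adjoint (d j)) := by
      unfold QQ
      rw [← ContinuousLinearMap.comp_assoc (Ring.inverse (lapl d (j + 1))), ← G_comm hdd hu,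
        ContinuousLinearMap.comp_assoc, ← ContinuousLinearMap.comp_assoc, ← hXd,
        ContinuousLinearMap.comp_assoc]
    rw [this, tr_comm (he j) ((hX j).comp ((hG j).comp (he j).adjoint))]
    rfl
  induction M with
  | zero =>
    have h2 : QQ d 0 = 0 := rfl
    rw [Finset.sum_range_one, h0, h2]
    simp [tr_zero]
  | succ M ih =>
    rw [Finset.sum_range_succ, ih, h0 (M + 1), h1]
    ring

theorem alt_ld (hdd : ∀ j, d (j + 1) ∘L d j = 0) (hu : ∀ j, IsUnit (lapl d j))
    (he : ∀ j, Eqv (d j)) (M : ℕ) [IsEmpty (ι M)] :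
    ∑ j ∈ Finset.range (M + 1), (-1 : ℝ) ^ j * ld (lapl d j) = 0 := by
  have hev : ∀ᶠ R : ℝ in Filter.atTop, ∀ j ∈ Finset.range (M + 1),
      spectrum ℝ (star (lapl d j) * lapl d j) ⊆ Set.Icc R⁻¹ R :=
    (Filter.eventually_all_finset _).2 fun j _ => eventually_spec (hu j)
  obtain ⟨R, hRs, hR⟩ := (hev.and (Filter.eventually_ge_atTop 1)).exists
  obtain ⟨p, hp⟩ := exists_poly' hR
  have hRp : 0 < R⁻¹ := by positivity
  have t1 := tendsto_finsetSum (Finset.range (M + 1)) fun j hj =>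
    (ld_approx hRp hp (hRs j hj)).const_mul ((-1 : ℝ) ^ j)
  refine tendsto_nhds_unique t1 (tendsto_const_nhds.congr fun n => ?_)
  have := alt_sum hdd hu he (X := fun j => Polynomial.aeval (star (lapl d j) * lapl d j) (p n))
    (fun j => ?_) (fun j => ?_) M
  · rw [this, tr_empty, mul_zero]
  · rw [(sa_lapl d j).star_eq]
    exact ((eqv_lapl he j).mul (eqv_lapl he j)).aeval _
  · refine aeval_intertwine ?_ _
    rw [(sa_lapl d j).star_eq, (sa_lapl d (j + 1)).star_eq, ContinuousLinearMap.mul_def,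
      ContinuousLinearMap.mul_def, ← ContinuousLinearMap.comp_assoc, lapl_comm hdd,
      ContinuousLinearMap.comp_assoc, lapl_comm hdd, ContinuousLinearMap.comp_assoc]

/-- derivative of `QQ` -/
def QQ' (d F : ∀ j, Hn Γ (ι j) →L[ℂ] Hn Γ (ι (j + 1))) : (j : ℕ) → Hn Γ (ι j) →L[ℂ] Hn Γ (ι j)
  | 0 => 0
  | j + 1 => F j ∘L ContinuousLinearMap.adjoint (d j) + d j ∘L ContinuousLinearMap.adjoint (F j)

/-- derivative of the Laplacian -/
def lapl' (d F : ∀ j, Hn Γ (ι j) →L[ℂ] Hn Γ (ι (j + 1))) (j : ℕ) : Hn Γ (ι j) →L[ℂ] Hn Γ (ι j) :=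
  (ContinuousLinearMap.adjoint (F j) ∘L d j + ContinuousLinearMap.adjoint (d j) ∘L F j) + QQ' d F j

theorem sum_aux (u b w : ℕ → ℝ) (hu0 : u 0 = 0) (hb : ∀ j, b j = 2 * (u j + u (j + 1)))
    (hw : ∀ j, w (j + 1) = b (j + 1) + b j) (M : ℕ) :
    ∑ j ∈ Finset.range (M + 1), ((-1 : ℝ) ^ j * j) * w j
      = 2 * (-1) ^ M * (M * (u M + u (M + 1)) + u M) := by
  induction M with
  | zero => simp [hu0]
  | succ M ih =>
    rw [Finset.sum_range_succ, ih, hw, hb, hb]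
    push_cast
    ring

theorem var_alg (hdd : ∀ j, d (j + 1) ∘L d j = 0) (hu : ∀ j, IsUnit (lapl d j))
    (he : ∀ j, Eqv (d j)) {F : ∀ j, Hn Γ (ι j) →L[ℂ] Hn Γ (ι (j + 1))}
    {K : ∀ j, Hn Γ (ι j) →L[ℂ] Hn Γ (ι j)} (hK : ∀ j, Eqv (K j)) (htr : ∀ j, tr (K j) = 0)
    (hF : ∀ j, F j = d j ∘L K j - K (j + 1) ∘L d j) (M : ℕ) [IsEmpty (ι M)]
    [IsEmpty (ι (M + 1))] :
    ∑ j ∈ Finset.range (M + 1), ((-1 : ℝ) ^ j * j) *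
      (2 * tr (Ring.inverse (lapl d j) * lapl' d F j)) = 0 := by
  have hG : ∀ j, Eqv (Ring.inverse (lapl d j)) := fun j => (eqv_lapl he j).inverse
  have hFe : ∀ j, Eqv (F j) := fun j => by
    rw [hF]; exact ((he j).comp (hK j)).sub ((hK _).comp (he j))
  set G : ∀ j, Hn Γ (ι j) →L[ℂ] Hn Γ (ι j) := fun j => Ring.inverse (lapl d j) with hGdef
  set u : ℕ → ℝ := fun j => tr (G j ∘L PP d j ∘L K j) with hudef
  set v : ℕ → ℝ := fun j => tr (G j ∘L QQ d j ∘L K j) with hvdef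
  set b : ℕ → ℝ := fun j => 2 * tr (G j ∘L ContinuousLinearMap.adjoint (d j) ∘L F j) with hbdef
  have huv : ∀ j, u j + v j = 0 := by
    intro j
    rw [hudef, hvdef]
    simp only
    rw [← tr_add, ← ContinuousLinearMap.comp_add, ← ContinuousLinearMap.add_comp,
      ← ContinuousLinearMap.comp_assoc]
    have : G j ∘L (PP d j + QQ d j) = 1 := Ring.inverse_mul_cancel _ (hu j)
    rw [this]
    exact htr j
  have hv0 : v 0 = 0 := by
    have h2 : QQ d 0 = 0 := rfl
    rw [hvdef]; simp only; rw [h2]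
    simp [tr_zero]
  have hu0 : u 0 = 0 := by have := huv 0; linarith
  have hb : ∀ j, b j = 2 * (u j + u (j + 1)) := by
    intro j
    have h1 : G j ∘L ContinuousLinearMap.adjoint (d j) ∘L F j
        = G j ∘L PP d j ∘L K j
          - (G j ∘L ContinuousLinearMap.adjoint (d j) ∘L K (j + 1)) ∘L d j := by
      rw [hF]
      simp only [ContinuousLinearMap.comp_sub, PP, ContinuousLinearMap.comp_assoc]
    have h2 : tr ((G j ∘L ContinuousLinearMap.adjoint (d j) ∘L K (j + 1)) ∘L d j) = v (j + 1) := by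
      rw [tr_comm ((hG j).comp ((he j).adjoint.comp (hK _))) (he j),
        ← ContinuousLinearMap.comp_assoc, G_comm hdd hu j]
      rfl
    rw [hbdef]
    simp only
    rw [h1, tr_sub, h2]
    have := huv (j + 1)
    have h3 : v (j + 1) = - u (j + 1) := by linarith
    rw [h3]
    change 2 * (u j - - u (j + 1)) = _
    ring
  have hPd : ∀ j, tr (G j ∘L (ContinuousLinearMap.adjoint (F j) ∘L d j
      + ContinuousLinearMap.adjoint (d j) ∘L F j)) = b j := by
    intro j
    rw [ContinuousLinearMap.comp_add, tr_add]
    have h1 : tr (G j ∘L ContinuousLinearMap.adjoint (F j) ∘L d j)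
        = tr (G j ∘L ContinuousLinearMap.adjoint (d j) ∘L F j) := by
      rw [← tr_adjoint, ContinuousLinearMap.adjoint_comp, ContinuousLinearMap.adjoint_comp,
        ContinuousLinearMap.adjoint_adjoint, sa_G hu j]
      exact tr_comm ((he j).adjoint.comp (hFe j)) (hG j)
    rw [h1, hbdef]
    ring
  have hQd : ∀ j, tr (G (j + 1) ∘L QQ' d F (j + 1)) = b j := by
    intro j
    unfold QQ'
    rw [ContinuousLinearMap.comp_add, tr_add]
    have h1 : tr (G (j + 1) ∘L d j ∘L ContinuousLinearMap.adjoint (F j))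
        = tr (G (j + 1) ∘L F j ∘L ContinuousLinearMap.adjoint (d j)) := by
      rw [← tr_adjoint, ContinuousLinearMap.adjoint_comp, ContinuousLinearMap.adjoint_comp,
        ContinuousLinearMap.adjoint_adjoint, sa_G hu (j + 1)]
      exact tr_comm ((hFe j).comp (he j).adjoint) (hG _)
    have h2 : tr (G (j + 1) ∘L F j ∘L ContinuousLinearMap.adjoint (d j))
        = tr (G j ∘L ContinuousLinearMap.adjoint (d j) ∘L F j) := by
      rw [← ContinuousLinearMap.comp_assoc, tr_comm ((hG _).comp (hFe j)) (he j).adjoint,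
        ← ContinuousLinearMap.comp_assoc, hGdef]
      simp only
      rw [G_comm' hdd hu j]
      rfl
    rw [h1, h2, hbdef]
    ring
  have hw : ∀ j, tr (G (j + 1) * lapl' d F (j + 1)) = b (j + 1) + b j := by
    intro j
    unfold lapl'
    rw [mul_add, tr_add]
    exact congrArg₂ (· + ·) (hPd (j + 1)) (hQd j)
  have hfin := sum_aux u b (fun j => tr (G j * lapl' d F j)) hu0 hb hw M
  have e1 : u M = 0 := tr_empty _
  have e2 : u (M + 1) = 0 := tr_empty _
  rw [e1, e2] at hfin
  have : ∀ j, ((-1 : ℝ) ^ j * j) * (2 * tr (G j * lapl' d F j))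
      = 2 * (((-1 : ℝ) ^ j * j) * tr (G j * lapl' d F j)) := fun j => by ring
  refine (Finset.sum_congr rfl fun j _ => this j).trans ?_
  rw [← Finset.mul_sum, hfin]
  ring

theorem lapl_unit_of_contraction
    {h : ∀ j, Hn Γ (ι (j + 1)) →L[ℂ] Hn Γ (ι j)} (h0 : h 0 ∘L d 0 = 1)
    (hs : ∀ j, h (j + 1) ∘L d (j + 1) + d j ∘L h j = 1) (j : ℕ) : IsUnit (lapl d j) := by
  cases j with
  | zero =>
    have := coercive_unit (d 0) (0 : Hn Γ (ι 0) →L[ℂ] Hn Γ (ι 0)) (h 0) 0 (by simpa using h0)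
    simpa [lapl, PP, QQ] using this
  | succ j => exact coercive_unit (d (j + 1)) (d j) (h (j + 1)) (h j) (hs j)

/-- the standard contraction -/
def ctr (d : ∀ j, Hn Γ (ι j) →L[ℂ] Hn Γ (ι (j + 1))) (j : ℕ) :
    Hn Γ (ι (j + 1)) →L[ℂ] Hn Γ (ι j) :=
  Ring.inverse (lapl d j) ∘L ContinuousLinearMap.adjoint (d j)

theorem ctr_zero (hu : ∀ j, IsUnit (lapl d j)) : ctr d 0 ∘L d 0 = 1 := by
  have : Ring.inverse (lapl d 0) ∘L (PP d 0 + QQ d 0) = 1 := Ring.inverse_mul_cancel _ (hu 0)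
  have h2 : QQ d 0 = 0 := rfl
  rw [h2, add_zero] at this
  exact this

theorem ctr_succ (hdd : ∀ j, d (j + 1) ∘L d j = 0) (hu : ∀ j, IsUnit (lapl d j)) (j : ℕ) :
    ctr d (j + 1) ∘L d (j + 1) + d j ∘L ctr d j = 1 := by
  have : Ring.inverse (lapl d (j + 1)) ∘L (PP d (j + 1) + QQ d (j + 1)) = 1 :=
    Ring.inverse_mul_cancel _ (hu _)
  rw [ContinuousLinearMap.comp_add] at this
  rw [← this]
  unfold ctr
  rw [← ContinuousLinearMap.comp_assoc (d j), G_comm hdd hu]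
  rfl

theorem eqv_ctr (he : ∀ j, Eqv (d j)) (j : ℕ) : Eqv (ctr d j) :=
  (eqv_lapl he j).inverse.comp (he j).adjoint

end complexes

section variation
variable {ι : ℕ → Type} [∀ j, Fintype (ι j)]
variable {d F : ∀ j, Hn Γ (ι j) →L[ℂ] Hn Γ (ι (j + 1))} {K : ∀ j, Hn Γ (ι j) →L[ℂ] Hn Γ (ι j)}

/-- the path -/
def dt (d F : ∀ j, Hn Γ (ι j) →L[ℂ] Hn Γ (ι (j + 1))) (t : ℝ) (j : ℕ) :
    Hn Γ (ι j) →L[ℂ] Hn Γ (ι (j + 1)) := d j + t • F j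

theorem rsmul_comp {α β γ : Type} [Fintype α] [Fintype β] [Fintype γ] (t : ℝ)
    (S : Hn Γ β →L[ℂ] Hn Γ γ) (T : Hn Γ α →L[ℂ] Hn Γ β) : (t • S) ∘L T = t • (S ∘L T) :=
  ContinuousLinearMap.smul_comp (t : ℂ) S T

theorem comp_rsmul {α β γ : Type} [Fintype α] [Fintype β] [Fintype γ] (t : ℝ)
    (S : Hn Γ β →L[ℂ] Hn Γ γ) (T : Hn Γ α →L[ℂ] Hn Γ β) : S ∘L (t • T) = t • (S ∘L T) :=
  ContinuousLinearMap.comp_smul S (t : ℂ) T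

section
variable {α β : Type} [Fintype α] [Fintype β]
theorem rsmul_mul (t : ℝ) (S T : Hn Γ α →L[ℂ] Hn Γ α) : (t • S) * (t • T) = (t * t) • (S * T) := by
  change (t • S) ∘L (t • T) = (t * t) • (S ∘L T)
  rw [rsmul_comp, comp_rsmul, smul_smul]
theorem rsmul_zero (t : ℝ) : t • (0 : Hn Γ α →L[ℂ] Hn Γ β) = 0 := by
  ext1 x; exact smul_zero t
theorem zero_rsmul (S : Hn Γ α →L[ℂ] Hn Γ β) : (0 : ℝ) • S = 0 := zero_smul ℝ S
theorem one_rsmul (S : Hn Γ α →L[ℂ] Hn Γ β) : (1 : ℝ) • S = S := one_smul ℝ S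
theorem rsmul_add (t : ℝ) (S T : Hn Γ α →L[ℂ] Hn Γ β) : t • (S + T) = t • S + t • T :=
  smul_add t S T
theorem rsmul_sub (t : ℝ) (S T : Hn Γ α →L[ℂ] Hn Γ β) : t • (S - T) = t • S - t • T :=
  smul_sub t S T
end

theorem FK_zero (hF : ∀ j, F j = d j ∘L K j - K (j + 1) ∘L d j) (hKK : ∀ j, K j ∘L K j = 0)
    (hKdK : ∀ j, K (j + 1) ∘L d j ∘L K j = 0) (j : ℕ) : F j ∘L K j = 0 := by
  rw [hF, ContinuousLinearMap.sub_comp, ContinuousLinearMap.comp_assoc,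
    ContinuousLinearMap.comp_assoc, hKK, hKdK]
  simp

theorem KF_zero (hF : ∀ j, F j = d j ∘L K j - K (j + 1) ∘L d j) (hKK : ∀ j, K j ∘L K j = 0)
    (hKdK : ∀ j, K (j + 1) ∘L d j ∘L K j = 0) (j : ℕ) : K (j + 1) ∘L F j = 0 := by
  rw [hF, ContinuousLinearMap.comp_sub, ← ContinuousLinearMap.comp_assoc (K (j + 1)) (K (j + 1)),
    hKK, hKdK]
  simp

theorem dt_dt (hdd : ∀ j, d (j + 1) ∘L d j = 0)
    (hF : ∀ j, F j = d j ∘L K j - K (j + 1) ∘L d j) (hKK : ∀ j, K j ∘L K j = 0)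
    (hKdK : ∀ j, K (j + 1) ∘L d j ∘L K j = 0) (t : ℝ) (j : ℕ) :
    dt d F t (j + 1) ∘L dt d F t j = 0 := by
  have h1 : d (j + 1) ∘L F j + F (j + 1) ∘L d j = 0 := by
    rw [hF, hF, ContinuousLinearMap.comp_sub, ContinuousLinearMap.sub_comp,
      ← ContinuousLinearMap.comp_assoc (d (j + 1)) (d j), hdd,
      ContinuousLinearMap.comp_assoc (K (j + 1 + 1)), hdd, ContinuousLinearMap.comp_assoc]
    simp
  have h3 : F (j + 1) ∘L d j ∘L K j = 0 := by
    rw [hF, ContinuousLinearMap.sub_comp, ContinuousLinearMap.comp_assoc (d (j + 1)), hKdK,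
      ContinuousLinearMap.comp_assoc (K (j + 1 + 1)),
      ← ContinuousLinearMap.comp_assoc (d (j + 1)), hdd]
    simp
  have h2 : F (j + 1) ∘L F j = 0 := by
    rw [hF j, ContinuousLinearMap.comp_sub, h3, ← ContinuousLinearMap.comp_assoc,
      FK_zero hF hKK hKdK]
    simp
  unfold dt
  rw [ContinuousLinearMap.comp_add, ContinuousLinearMap.add_comp, ContinuousLinearMap.add_comp,
    hdd, comp_rsmul, rsmul_comp, comp_rsmul, rsmul_comp, h2, zero_add, rsmul_zero, rsmul_zero,
    add_zero, ← rsmul_add, add_comm (F (j + 1) ∘L d j), h1, rsmul_zero]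

theorem dt_conj (hF : ∀ j, F j = d j ∘L K j - K (j + 1) ∘L d j)
    (hKdK : ∀ j, K (j + 1) ∘L d j ∘L K j = 0) (t : ℝ) (j : ℕ) :
    dt d F t j = (1 - t • K (j + 1)) ∘L d j ∘L (1 + t • K j) := by
  have e : (1 - t • K (j + 1)) ∘L d j ∘L (1 + t • K j)
      = d j + t • (d j ∘L K j) - t • (K (j + 1) ∘L d j) - (t * t) • (K (j + 1) ∘L d j ∘L K j) := by
    rw [ContinuousLinearMap.comp_add, ContinuousLinearMap.sub_comp, ContinuousLinearMap.comp_add,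
      ContinuousLinearMap.comp_add, comp_rsmul, comp_rsmul, comp_rsmul, rsmul_comp, rsmul_comp,
      smul_smul]
    have h1 : (1 : Hn Γ (ι (j + 1)) →L[ℂ] Hn Γ (ι (j + 1))) ∘L (d j ∘L 1) = d j := rfl
    have h2 : (1 : Hn Γ (ι (j + 1)) →L[ℂ] Hn Γ (ι (j + 1))) ∘L (d j ∘L K j) = d j ∘L K j := rfl
    have h3 : K (j + 1) ∘L (d j ∘L 1) = K (j + 1) ∘L d j := rfl
    rw [h1, h2, h3]
    abel
  rw [e, hKdK, rsmul_zero, sub_zero, dt, hF, rsmul_sub]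
  abel

theorem dt_unit (hdd : ∀ j, d (j + 1) ∘L d j = 0) (hu : ∀ j, IsUnit (lapl d j))
    (hF : ∀ j, F j = d j ∘L K j - K (j + 1) ∘L d j) (hKK : ∀ j, K j ∘L K j = 0)
    (hKdK : ∀ j, K (j + 1) ∘L d j ∘L K j = 0) (t : ℝ) (j : ℕ) : IsUnit (lapl (dt d F t) j) := by
  have hKK' : ∀ j, K j * K j = 0 := hKK
  have i1 : ∀ j, (1 + t • K j) ∘L (1 - t • K j) = 1 := fun j => by
    change (1 + t • K j) * (1 - t • K j) = 1
    rw [mul_sub, mul_one, add_mul, one_mul, rsmul_mul, hKK', rsmul_zero]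
    abel
  have i2 : ∀ j, (1 - t • K j) ∘L (1 + t • K j) = 1 := fun j => by
    change (1 - t • K j) * (1 + t • K j) = 1
    rw [mul_add, mul_one, sub_mul, one_mul, rsmul_mul, hKK', rsmul_zero]
    abel
  have aux1 : ∀ j, ((1 - t • K j) ∘L ctr d j ∘L (1 + t • K (j + 1))) ∘L dt d F t j
      = (1 - t • K j) ∘L (ctr d j ∘L d j) ∘L (1 + t • K j) := fun j => by
    rw [dt_conj hF hKdK]
    calc _ = (1 - t • K j) ∘L ctr d j ∘L ((1 + t • K (j + 1)) ∘L (1 - t • K (j + 1))) ∘L d j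
          ∘L (1 + t • K j) := rfl
      _ = _ := by rw [i1]; rfl
  have aux2 : ∀ j, dt d F t j ∘L ((1 - t • K j) ∘L ctr d j ∘L (1 + t • K (j + 1)))
      = (1 - t • K (j + 1)) ∘L (d j ∘L ctr d j) ∘L (1 + t • K (j + 1)) := fun j => by
    rw [dt_conj hF hKdK]
    calc _ = (1 - t • K (j + 1)) ∘L d j ∘L ((1 + t • K j) ∘L (1 - t • K j)) ∘L ctr d j
          ∘L (1 + t • K (j + 1)) := rfl
      _ = _ := by rw [i1]; rfl
  refine lapl_unit_of_contraction
    (h := fun j => (1 - t • K j) ∘L ctr d j ∘L (1 + t • K (j + 1))) ?_ ?_ j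
  · rw [aux1, ctr_zero hu]
    exact i2 0
  · intro j
    rw [aux1, aux2, ← ContinuousLinearMap.comp_add, ← ContinuousLinearMap.add_comp,
      ctr_succ hdd hu]
    exact i2 _

theorem hasDerivAt_lapl (t : ℝ) (j : ℕ) :
    HasDerivAt (fun s => lapl (dt d F s) j) (lapl' (dt d F t) F j) t := by
  have hP : HasDerivAt (fun s => PP (dt d F s) j)
      (ContinuousLinearMap.adjoint (F j) ∘L dt d F t j
        + ContinuousLinearMap.adjoint (dt d F t j) ∘L F j) t := by
    have := hasDerivAt_bilin (ContinuousLinearMap.adjoint (d j)) (ContinuousLinearMap.adjoint (F j))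
      (d j) (F j) t
    unfold PP dt
    simp only [adjoint_affine]
    exact this
  have hQ : HasDerivAt (fun s => QQ (dt d F s) j) (QQ' (dt d F t) F j) t := by
    cases j with
    | zero => exact hasDerivAt_const t _
    | succ j =>
      have := hasDerivAt_bilin (d j) (F j) (ContinuousLinearMap.adjoint (d j))
        (ContinuousLinearMap.adjoint (F j)) t
      unfold QQ QQ' dt
      simp only [adjoint_affine]
      exact this
  exact hP.add hQ

theorem continuous_lapl' (j : ℕ) : Continuous (fun s => lapl' (dt d F s) F j) := by
  have h1 : ∀ j, Continuous (fun s => dt d F s j) := fun j =>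
    continuous_const.add (continuous_id.smul continuous_const)
  have h2 : ∀ j, Continuous (fun s => ContinuousLinearMap.adjoint (dt d F s j)) := fun j =>
    ContinuousLinearMap.adjoint.continuous.comp (h1 j)
  refine Continuous.add (Continuous.add (continuous_const.clm_comp (h1 j))
    ((h2 j).clm_comp continuous_const)) ?_
  cases j with
  | zero => exact continuous_const
  | succ j => exact (continuous_const.clm_comp (h2 j)).add ((h1 j).clm_comp continuous_const)

theorem sa_lapl'' (j : ℕ) : IsSelfAdjoint (lapl' d F j) := by
  change ContinuousLinearMap.adjoint (lapl' d F j) = _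
  unfold lapl'
  rw [map_add]
  congr 1
  · rw [map_add, ContinuousLinearMap.adjoint_comp, ContinuousLinearMap.adjoint_comp,
      ContinuousLinearMap.adjoint_adjoint, ContinuousLinearMap.adjoint_adjoint, add_comm]
  · cases j with
    | zero => exact map_zero _
    | succ j =>
      change ContinuousLinearMap.adjoint (F j ∘L ContinuousLinearMap.adjoint (d j)
        + d j ∘L ContinuousLinearMap.adjoint (F j)) = F j ∘L ContinuousLinearMap.adjoint (d j)
        + d j ∘L ContinuousLinearMap.adjoint (F j)
      rw [map_add, ContinuousLinearMap.adjoint_comp, ContinuousLinearMap.adjoint_comp,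
        ContinuousLinearMap.adjoint_adjoint, ContinuousLinearMap.adjoint_adjoint,
        add_comm (d j ∘L ContinuousLinearMap.adjoint (F j))]

theorem eqv_lapl' (he : ∀ j, Eqv (d j)) (hFe : ∀ j, Eqv (F j)) (j : ℕ) : Eqv (lapl' d F j) := by
  refine Eqv.add (((hFe j).adjoint.comp (he j)).add ((he j).adjoint.comp (hFe j))) ?_
  cases j with
  | zero => exact Eqv.zero
  | succ j => exact ((hFe j).comp (he j).adjoint).add ((he j).comp (hFe j).adjoint)

theorem variation (hdd : ∀ j, d (j + 1) ∘L d j = 0) (hu : ∀ j, IsUnit (lapl d j))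
    (he : ∀ j, Eqv (d j)) (hK : ∀ j, Eqv (K j)) (htr : ∀ j, tr (K j) = 0)
    (hF : ∀ j, F j = d j ∘L K j - K (j + 1) ∘L d j) (hKK : ∀ j, K j ∘L K j = 0)
    (hKdK : ∀ j, K (j + 1) ∘L d j ∘L K j = 0) (M : ℕ) [IsEmpty (ι M)] [IsEmpty (ι (M + 1))] :
    ∑ j ∈ Finset.range (M + 1), ((-1 : ℝ) ^ j * j) * ld (lapl (fun j => d j + F j) j)
      = ∑ j ∈ Finset.range (M + 1), ((-1 : ℝ) ^ j * j) * ld (lapl d j) := by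
  have hFe : ∀ j, Eqv (F j) := fun j => by
    rw [hF]; exact ((he j).comp (hK j)).sub ((hK _).comp (he j))
  have hte : ∀ t j, Eqv (dt d F t j) := fun t j => (he j).add ((hFe j).smul t)
  have hder : ∀ t, HasDerivAt (fun t => ∑ j ∈ Finset.range (M + 1),
      ((-1 : ℝ) ^ j * j) * ld (lapl (dt d F t) j)) 0 t := by
    intro t
    have h1 : ∀ j ∈ Finset.range (M + 1), HasDerivAt
        (fun t => ((-1 : ℝ) ^ j * j) * ld (lapl (dt d F t) j))
        (((-1 : ℝ) ^ j * j) * (2 * tr (Ring.inverse (lapl (dt d F t) j) * lapl' (dt d F t) F j))) t :=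
      fun j _ => (hasDerivAt_ld (Δ := fun s => lapl (dt d F s) j)
        (Δ' := fun s => lapl' (dt d F s) F j) (fun s => hasDerivAt_lapl s j)
        (fun s => sa_lapl _ j) (fun s => sa_lapl'' j)
        (fun s => dt_unit hdd hu hF hKK hKdK s j) (fun s => eqv_lapl (hte s) j)
        (fun s => eqv_lapl' (hte s) hFe j) (continuous_lapl' j) t).const_mul _
    have h2 := HasDerivAt.fun_sum h1
    rw [var_alg (dt_dt hdd hF hKK hKdK t) (dt_unit hdd hu hF hKK hKdK t) (hte t) hK htr
      (fun j => ?_) M] at h2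
    · exact h2
    · unfold dt
      rw [ContinuousLinearMap.add_comp, ContinuousLinearMap.comp_add, rsmul_comp, comp_rsmul,
        FK_zero hF hKK hKdK, KF_zero hF hKK hKdK, rsmul_zero, add_zero, add_zero, hF]
  have h := is_const_of_deriv_eq_zero (fun t => (hder t).differentiableAt)
    (fun t => (hder t).deriv) 1 0
  have e1 : dt d F 1 = fun j => d j + F j := by funext j; unfold dt; rw [one_rsmul]
  have e0 : dt d F 0 = d := by funext j; unfold dt; rw [zero_rsmul, add_zero]
  simp only [e1, e0] at h
  exact h

end variation

section RAfacts

theorem rho_mul (a b : Γ) : rho (a * b) = rho a ∘L rho b := by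
  ext f x
  simp [rho_apply, mul_assoc]

theorem rho_one : rho (1 : Γ) = 1 := by
  ext f x
  simp [rho_apply]

/-- `rho` as a monoid hom -/
def rhoHom (Γ : Type) [Group Γ] : Γ →* (l2 Γ →L[ℂ] l2 Γ) where
  toFun := rho
  map_one' := rho_one
  map_mul' := rho_mul

theorem Rop_eq (a : MonoidAlgebra ℤ Γ) :
    Rop a = MonoidAlgebra.lift ℤ (l2 Γ →L[ℂ] l2 Γ) Γ (rhoHom Γ) a := by
  rw [MonoidAlgebra.lift_apply]
  unfold Rop
  refine Finsupp.sum_congr fun γ _ => ?_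
  rw [Int.cast_smul_eq_zsmul]
  rfl

theorem Rop_mul (a b : MonoidAlgebra ℤ Γ) : Rop (a * b) = Rop a ∘L Rop b := by
  simp only [Rop_eq, map_mul]; rfl

theorem Rop_zero : Rop (0 : MonoidAlgebra ℤ Γ) = 0 := by
  simp only [Rop_eq, map_zero]

theorem Rop_neg (a : MonoidAlgebra ℤ Γ) : Rop (-a) = - Rop a := by
  simp only [Rop_eq, map_neg]

theorem Rop_sum {α : Type} (s : Finset α) (a : α → MonoidAlgebra ℤ Γ) :
    Rop (∑ i ∈ s, a i) = ∑ i ∈ s, Rop (a i) := by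
  simp only [Rop_eq, map_sum]

variable {ι κ μ ν : Type} [Fintype ι] [Fintype κ] [Fintype μ] [Fintype ν]

theorem projL_apply (j : ι) (f : Hn Γ ι) : projL Γ j f = f j := rfl

theorem inclL_apply [DecidableEq ι] (i k : ι) (f : l2 Γ) :
    (inclL Γ i f : Hn Γ ι) k = if k = i then f else 0 := by
  change (Pi.single i f : ι → l2 Γ) k = _
  rw [Pi.single_apply]

theorem hn_sum_apply {α : Type} (s : Finset α) (f : α → Hn Γ ι) (k : ι) :
    (∑ a ∈ s, f a) k = ∑ a ∈ s, f a k := by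
  classical
  induction s using Finset.induction_on with
  | empty => rfl
  | insert a s ha ih => rw [Finset.sum_insert ha, Finset.sum_insert ha, ← ih]; rfl

theorem RA_apply (A : Matrix ι κ (MonoidAlgebra ℤ Γ)) (f : Hn Γ κ) (i : ι) :
    (RA A f) i = ∑ j, Rop (A i j) (f j) := by
  classical
  unfold RA
  simp only [ContinuousLinearMap.sum_apply, hn_sum_apply, ContinuousLinearMap.comp_apply,
    inclL_apply, projL_apply]
  rw [Finset.sum_eq_single i]
  · simp
  · intro b _ hb
    simp [hb.symm]
  · simp

theorem RA_mul (A : Matrix ι κ (MonoidAlgebra ℤ Γ)) (B : Matrix κ μ (MonoidAlgebra ℤ Γ)) :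
    RA (A * B) = RA A ∘L RA B := by
  ext1 f
  refine PiLp.ext fun i => ?_
  rw [ContinuousLinearMap.comp_apply, RA_apply, RA_apply]
  simp only [RA_apply, Matrix.mul_apply, Rop_sum, Rop_mul, ContinuousLinearMap.sum_apply, map_sum,
    ContinuousLinearMap.comp_apply]
  rw [Finset.sum_comm]

theorem RA_zero : RA (0 : Matrix ι κ (MonoidAlgebra ℤ Γ)) = 0 := by
  ext1 f
  refine PiLp.ext fun i => ?_
  rw [RA_apply]
  simp [Rop_zero]

theorem RA_neg (A : Matrix ι κ (MonoidAlgebra ℤ Γ)) : RA (-A) = - RA A := by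
  ext1 f
  refine PiLp.ext fun i => ?_
  rw [RA_apply]
  change _ = - (RA A f) i
  rw [RA_apply]
  simp [Rop_neg]

theorem rho_lam (a b : Γ) (f : l2 Γ) : rho a (lam b f) = lam b (rho a f) := by
  ext x
  simp [rho_apply, lam_apply, mul_assoc]

theorem Rop_lam (a : MonoidAlgebra ℤ Γ) (b : Γ) (f : l2 Γ) :
    Rop a (lam b f) = lam b (Rop a f) := by
  unfold Rop Finsupp.sum
  simp only [ContinuousLinearMap.sum_apply, ContinuousLinearMap.smul_apply, rho_lam, map_sum,
    map_smul]

theorem eqv_RA (A : Matrix ι κ (MonoidAlgebra ℤ Γ)) : Eqv (RA A) := by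
  intro γ
  ext1 f
  refine PiLp.ext fun i => ?_
  rw [ContinuousLinearMap.comp_apply, ContinuousLinearMap.comp_apply, Lt_apply, RA_apply, RA_apply,
    map_sum]
  simp only [Lt_apply, Rop_lam]

/-- inclusion along an injective map of index types -/
def Vl (Γ : Type) [Group Γ] (ι κ : Type) [Fintype ι] [Fintype κ] : Hn Γ ι →L[ℂ] Hn Γ (ι ⊕ κ) :=
  letI := Classical.decEq (ι ⊕ κ)
  ∑ i, inclL Γ (Sum.inl i : ι ⊕ κ) ∘L projL Γ i

/-- inclusion of the second summand -/
def Vr (Γ : Type) [Group Γ] (ι κ : Type) [Fintype ι] [Fintype κ] : Hn Γ κ →L[ℂ] Hn Γ (ι ⊕ κ) :=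
  letI := Classical.decEq (ι ⊕ κ)
  ∑ i, inclL Γ (Sum.inr i : ι ⊕ κ) ∘L projL Γ i

/-- projection to the first summand -/
def Vl' (Γ : Type) [Group Γ] (ι κ : Type) [Fintype ι] [Fintype κ] : Hn Γ (ι ⊕ κ) →L[ℂ] Hn Γ ι :=
  letI := Classical.decEq ι
  ∑ i, inclL Γ i ∘L projL Γ (Sum.inl i : ι ⊕ κ)

/-- projection to the second summand -/
def Vr' (Γ : Type) [Group Γ] (ι κ : Type) [Fintype ι] [Fintype κ] : Hn Γ (ι ⊕ κ) →L[ℂ] Hn Γ κ :=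
  letI := Classical.decEq κ
  ∑ i, inclL Γ i ∘L projL Γ (Sum.inr i : ι ⊕ κ)

theorem Vl_inl (f : Hn Γ ι) (i : ι) : (Vl Γ ι κ f) (Sum.inl i) = f i := by
  classical
  unfold Vl
  simp [hn_sum_apply, inclL_apply, projL_apply]

theorem Vl_inr (f : Hn Γ ι) (i : κ) : (Vl Γ ι κ f) (Sum.inr i) = 0 := by
  classical
  unfold Vl
  simp [hn_sum_apply, inclL_apply, projL_apply]

theorem Vr_inl (f : Hn Γ κ) (i : ι) : (Vr Γ ι κ f) (Sum.inl i) = 0 := by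
  classical
  unfold Vr
  simp [hn_sum_apply, inclL_apply, projL_apply]

theorem Vr_inr (f : Hn Γ κ) (i : κ) : (Vr Γ ι κ f) (Sum.inr i) = f i := by
  classical
  unfold Vr
  simp [hn_sum_apply, inclL_apply, projL_apply]

theorem Vl'_apply (f : Hn Γ (ι ⊕ κ)) (i : ι) : (Vl' Γ ι κ f) i = f (Sum.inl i) := by
  classical
  unfold Vl'
  simp [hn_sum_apply, inclL_apply, projL_apply]

theorem Vr'_apply (f : Hn Γ (ι ⊕ κ)) (i : κ) : (Vr' Γ ι κ f) i = f (Sum.inr i) := by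
  classical
  unfold Vr'
  simp [hn_sum_apply, inclL_apply, projL_apply]

theorem adjoint_Vl : ContinuousLinearMap.adjoint (Vl Γ ι κ) = Vl' Γ ι κ := by
  symm
  rw [ContinuousLinearMap.eq_adjoint_iff]
  intro x y
  rw [PiLp.inner_apply, PiLp.inner_apply, Fintype.sum_sum_type]
  simp [Vl_inl, Vl_inr, Vl'_apply]

theorem adjoint_Vr : ContinuousLinearMap.adjoint (Vr Γ ι κ) = Vr' Γ ι κ := by
  symm
  rw [ContinuousLinearMap.eq_adjoint_iff]
  intro x y
  rw [PiLp.inner_apply, PiLp.inner_apply, Fintype.sum_sum_type]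
  simp [Vr_inl, Vr_inr, Vr'_apply]

theorem eqv_Vl : Eqv (Vl Γ ι κ) := by
  intro γ
  ext1 f
  refine PiLp.ext fun i => ?_
  rw [ContinuousLinearMap.comp_apply, ContinuousLinearMap.comp_apply, Lt_apply]
  cases i with
  | inl i => rw [Vl_inl, Vl_inl, Lt_apply]
  | inr i => rw [Vl_inr, Vl_inr, map_zero]

theorem eqv_Vr : Eqv (Vr Γ ι κ) := by
  intro γ
  ext1 f
  refine PiLp.ext fun i => ?_
  rw [ContinuousLinearMap.comp_apply, ContinuousLinearMap.comp_apply, Lt_apply]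
  cases i with
  | inl i => rw [Vr_inl, Vr_inl, map_zero]
  | inr i => rw [Vr_inr, Vr_inr, Lt_apply]

theorem eqv_Vl' : Eqv (Vl' Γ ι κ) := by rw [← adjoint_Vl]; exact eqv_Vl.adjoint
theorem eqv_Vr' : Eqv (Vr' Γ ι κ) := by rw [← adjoint_Vr]; exact eqv_Vr.adjoint

theorem Vl'_Vl : Vl' Γ ι κ ∘L Vl Γ ι κ = 1 := by
  ext1 f
  refine PiLp.ext fun i => ?_
  rw [ContinuousLinearMap.comp_apply, Vl'_apply, Vl_inl]; rfl

theorem Vr'_Vr : Vr' Γ ι κ ∘L Vr Γ ι κ = 1 := by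
  ext1 f
  refine PiLp.ext fun i => ?_
  rw [ContinuousLinearMap.comp_apply, Vr'_apply, Vr_inr]; rfl

theorem Vl'_Vr : Vl' Γ ι κ ∘L Vr Γ ι κ = 0 := by
  ext1 f
  refine PiLp.ext fun i => ?_
  rw [ContinuousLinearMap.comp_apply, Vl'_apply, Vr_inl]; rfl

theorem Vr'_Vl : Vr' Γ ι κ ∘L Vl Γ ι κ = 0 := by
  ext1 f
  refine PiLp.ext fun i => ?_
  rw [ContinuousLinearMap.comp_apply, Vr'_apply, Vl_inr]; rfl

theorem V_add : Vl Γ ι κ ∘L Vl' Γ ι κ + Vr Γ ι κ ∘L Vr' Γ ι κ = 1 := by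
  ext1 f
  refine PiLp.ext fun i => ?_
  change (Vl Γ ι κ (Vl' Γ ι κ f)) i + (Vr Γ ι κ (Vr' Γ ι κ f)) i = f i
  cases i with
  | inl i => rw [Vl_inl, Vr_inl, Vl'_apply, add_zero]
  | inr i => rw [Vl_inr, Vr_inr, Vr'_apply, zero_add]

/-- lower triangular block operator -/
theorem RA_blocks (A : Matrix ι μ (MonoidAlgebra ℤ Γ)) (B : Matrix κ μ (MonoidAlgebra ℤ Γ))
    (D : Matrix κ ν (MonoidAlgebra ℤ Γ)) :
    RA (Matrix.fromBlocks A 0 B D) = (Vl Γ ι κ ∘L RA A ∘L Vl' Γ μ ν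
      + Vr Γ ι κ ∘L RA D ∘L Vr' Γ μ ν) + Vr Γ ι κ ∘L RA B ∘L Vl' Γ μ ν := by
  ext1 f
  refine PiLp.ext fun i => ?_
  change _ = ((Vl Γ ι κ (RA A (Vl' Γ μ ν f))) i + (Vr Γ ι κ (RA D (Vr' Γ μ ν f))) i)
    + (Vr Γ ι κ (RA B (Vl' Γ μ ν f))) i
  rw [RA_apply, Fintype.sum_sum_type]
  cases i with
  | inl i =>
    rw [Vl_inl, Vr_inl, Vr_inl, RA_apply]
    simp [Vl'_apply, Rop_zero]
  | inr i =>
    rw [Vl_inr, Vr_inr, Vr_inr, RA_apply, RA_apply]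
    simp [Vl'_apply, Vr'_apply, add_comm]

end RAfacts

section blk
variable {ι κ μ ν α β : Type} [Fintype ι] [Fintype κ] [Fintype μ] [Fintype ν] [Fintype α] [Fintype β]

/-- block diagonal operator -/
def blk (S : Hn Γ ι →L[ℂ] Hn Γ μ) (T : Hn Γ κ →L[ℂ] Hn Γ ν) : Hn Γ (ι ⊕ κ) →L[ℂ] Hn Γ (μ ⊕ ν) :=
  Vl Γ μ ν ∘L S ∘L Vl' Γ ι κ + Vr Γ μ ν ∘L T ∘L Vr' Γ ι κ

theorem blk_Vl (S : Hn Γ ι →L[ℂ] Hn Γ μ) (T : Hn Γ κ →L[ℂ] Hn Γ ν) :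
    blk S T ∘L Vl Γ ι κ = Vl Γ μ ν ∘L S := by
  unfold blk
  rw [ContinuousLinearMap.add_comp]
  calc _ = Vl Γ μ ν ∘L S ∘L (Vl' Γ ι κ ∘L Vl Γ ι κ)
        + Vr Γ μ ν ∘L T ∘L (Vr' Γ ι κ ∘L Vl Γ ι κ) := rfl
    _ = Vl Γ μ ν ∘L S ∘L 1 + Vr Γ μ ν ∘L T ∘L 0 := by rw [Vl'_Vl, Vr'_Vl]
    _ = _ := by
      rw [ContinuousLinearMap.comp_zero, ContinuousLinearMap.comp_zero, add_zero]; rfl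

theorem blk_Vr (S : Hn Γ ι →L[ℂ] Hn Γ μ) (T : Hn Γ κ →L[ℂ] Hn Γ ν) :
    blk S T ∘L Vr Γ ι κ = Vr Γ μ ν ∘L T := by
  unfold blk
  rw [ContinuousLinearMap.add_comp]
  calc _ = Vl Γ μ ν ∘L S ∘L (Vl' Γ ι κ ∘L Vr Γ ι κ)
        + Vr Γ μ ν ∘L T ∘L (Vr' Γ ι κ ∘L Vr Γ ι κ) := rfl
    _ = Vl Γ μ ν ∘L S ∘L 0 + Vr Γ μ ν ∘L T ∘L 1 := by rw [Vl'_Vr, Vr'_Vr]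
    _ = _ := by
      rw [ContinuousLinearMap.comp_zero, ContinuousLinearMap.comp_zero, zero_add]; rfl

theorem Vl'_blk (S : Hn Γ ι →L[ℂ] Hn Γ μ) (T : Hn Γ κ →L[ℂ] Hn Γ ν) :
    Vl' Γ μ ν ∘L blk S T = S ∘L Vl' Γ ι κ := by
  unfold blk
  rw [ContinuousLinearMap.comp_add, ← ContinuousLinearMap.comp_assoc (Vl' Γ μ ν) (Vl Γ μ ν),
    ← ContinuousLinearMap.comp_assoc (Vl' Γ μ ν) (Vr Γ μ ν), Vl'_Vl, Vl'_Vr,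
    ContinuousLinearMap.zero_comp, add_zero]
  rfl

theorem blk_comp (S' : Hn Γ μ →L[ℂ] Hn Γ α) (T' : Hn Γ ν →L[ℂ] Hn Γ β)
    (S : Hn Γ ι →L[ℂ] Hn Γ μ) (T : Hn Γ κ →L[ℂ] Hn Γ ν) :
    blk S' T' ∘L blk S T = blk (S' ∘L S) (T' ∘L T) := by
  have h1 := blk_Vl S' T'
  have h2 := blk_Vr S' T'
  rw [blk.eq_def S T, ContinuousLinearMap.comp_add,
    ← ContinuousLinearMap.comp_assoc (blk S' T') (Vl Γ μ ν), h1,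
    ← ContinuousLinearMap.comp_assoc (blk S' T') (Vr Γ μ ν), h2]
  rfl

theorem blk_adjoint (S : Hn Γ ι →L[ℂ] Hn Γ μ) (T : Hn Γ κ →L[ℂ] Hn Γ ν) :
    ContinuousLinearMap.adjoint (blk S T)
      = blk (ContinuousLinearMap.adjoint S) (ContinuousLinearMap.adjoint T) := by
  unfold blk
  rw [map_add]
  simp only [ContinuousLinearMap.adjoint_comp]
  rw [adjoint_Vl, adjoint_Vr, ← adjoint_Vl (ι := ι) (κ := κ), ← adjoint_Vr (ι := ι) (κ := κ),
    ContinuousLinearMap.adjoint_adjoint, ContinuousLinearMap.adjoint_adjoint]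
  rfl

theorem blk_add (S S' : Hn Γ ι →L[ℂ] Hn Γ μ) (T T' : Hn Γ κ →L[ℂ] Hn Γ ν) :
    blk S T + blk S' T' = blk (S + S') (T + T') := by
  unfold blk
  simp only [ContinuousLinearMap.add_comp, ContinuousLinearMap.comp_add]
  abel

theorem blk_zero : blk (0 : Hn Γ ι →L[ℂ] Hn Γ μ) (0 : Hn Γ κ →L[ℂ] Hn Γ ν) = 0 := by
  unfold blk
  simp

theorem blk_one : blk (1 : Hn Γ ι →L[ℂ] Hn Γ ι) (1 : Hn Γ κ →L[ℂ] Hn Γ κ) = 1 := V_add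

theorem eqv_blk {S : Hn Γ ι →L[ℂ] Hn Γ μ} {T : Hn Γ κ →L[ℂ] Hn Γ ν} (hS : Eqv S) (hT : Eqv T) :
    Eqv (blk S T) :=
  (eqv_Vl.comp (hS.comp eqv_Vl')).add (eqv_Vr.comp (hT.comp eqv_Vr'))

theorem isUnit_blk {S : Hn Γ ι →L[ℂ] Hn Γ ι} {T : Hn Γ κ →L[ℂ] Hn Γ κ} (hS : IsUnit S)
    (hT : IsUnit T) : IsUnit (blk S T) := by
  have h1 : S ∘L Ring.inverse S = 1 := Ring.mul_inverse_cancel _ hS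
  have h2 : T ∘L Ring.inverse T = 1 := Ring.mul_inverse_cancel _ hT
  have h3 : Ring.inverse S ∘L S = 1 := Ring.inverse_mul_cancel _ hS
  have h4 : Ring.inverse T ∘L T = 1 := Ring.inverse_mul_cancel _ hT
  refine isUnit_iff_exists.2 ⟨blk (Ring.inverse S) (Ring.inverse T), ?_, ?_⟩
  · change blk S T ∘L blk (Ring.inverse S) (Ring.inverse T) = 1
    rw [blk_comp, h1, h2, blk_one]
  · change blk (Ring.inverse S) (Ring.inverse T) ∘L blk S T = 1
    rw [blk_comp, h3, h4, blk_one]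

theorem ld_blk {S : Hn Γ ι →L[ℂ] Hn Γ ι} {T : Hn Γ κ →L[ℂ] Hn Γ κ} (hSe : Eqv S) (hTe : Eqv T)
    (hS : IsUnit S) (hT : IsUnit T) (hSs : IsSelfAdjoint S) (hTs : IsSelfAdjoint T) :
    ld (blk S T) = ld S + ld T := by
  refine ld_block (V := Vl Γ ι κ) (W := Vr Γ ι κ) (V' := Vl' Γ ι κ) (W' := Vr' Γ ι κ)
    eqv_Vl eqv_Vr eqv_Vl' eqv_Vr' Vl'_Vl Vr'_Vr V_add hSe hTe (eqv_blk hSe hTe) hS hT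
    (isUnit_blk hS hT) hSs hTs ?_ (blk_Vl S T).symm (blk_Vr S T).symm
  change ContinuousLinearMap.adjoint (blk S T) = blk S T
  rw [blk_adjoint]
  exact congrArg₂ blk hSs hTs

end blk

section genericcone
variable {ι κ : ℕ → Type} [∀ j, Fintype (ι j)] [∀ j, Fintype (κ j)]
variable {a : ∀ j, Hn Γ (ι j) →L[ℂ] Hn Γ (ι (j + 1))}
variable {b : ∀ j, Hn Γ (κ j) →L[ℂ] Hn Γ (κ (j + 1))}

theorem lapl_blk (j : ℕ) :
    lapl (ι := fun j => ι j ⊕ κ j) (fun j => blk (a j) (b j)) j = blk (lapl a j) (lapl b j) := by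
  unfold lapl
  rw [← blk_add]
  congr 1
  · unfold PP
    rw [blk_adjoint, blk_comp]
  · cases j with
    | zero => exact blk_zero.symm
    | succ j =>
      change blk (a j) (b j) ∘L ContinuousLinearMap.adjoint (blk (a j) (b j)) = blk _ _
      rw [blk_adjoint, blk_comp]
      rfl

theorem generic_cone (hda : ∀ j, a (j + 1) ∘L a j = 0) (hdb : ∀ j, b (j + 1) ∘L b j = 0)
    (hua : ∀ j, IsUnit (lapl a j)) (hub : ∀ j, IsUnit (lapl b j))
    (hea : ∀ j, Eqv (a j)) (heb : ∀ j, Eqv (b j))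
    (f : ∀ j, Hn Γ (ι j) →L[ℂ] Hn Γ (κ (j + 1)))
    (k : ∀ j, Hn Γ (ι j) →L[ℂ] Hn Γ (κ j)) (hk : ∀ j, Eqv (k j))
    (hf : ∀ j, f j = b j ∘L k j - k (j + 1) ∘L a j) (M : ℕ) [IsEmpty (ι M)] [IsEmpty (κ M)]
    [IsEmpty (ι (M + 1))] [IsEmpty (κ (M + 1))] :
    ∑ j ∈ Finset.range (M + 1), ((-1 : ℝ) ^ j * j) * ld (lapl (ι := fun j => ι j ⊕ κ j)
        (fun j => blk (a j) (b j)
          + Vr Γ (ι (j + 1)) (κ (j + 1)) ∘L f j ∘L Vl' Γ (ι j) (κ j)) j)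
      = ∑ j ∈ Finset.range (M + 1), ((-1 : ℝ) ^ j * j) * ld (lapl a j)
        + ∑ j ∈ Finset.range (M + 1), ((-1 : ℝ) ^ j * j) * ld (lapl b j) := by
  have h := variation (ι := fun j => ι j ⊕ κ j) (d := fun j => blk (a j) (b j))
    (F := fun j => Vr Γ (ι (j + 1)) (κ (j + 1)) ∘L f j ∘L Vl' Γ (ι j) (κ j))
    (K := fun j => Vr Γ (ι j) (κ j) ∘L k j ∘L Vl' Γ (ι j) (κ j))
    (fun j => by rw [blk_comp, hda, hdb, blk_zero])
    (fun j => by rw [lapl_blk]; exact isUnit_blk (hua j) (hub j))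
    (fun j => eqv_blk (hea j) (heb j))
    (fun j => eqv_Vr.comp ((hk j).comp eqv_Vl'))
    (fun j => by
      rw [tr_comm eqv_Vr ((hk j).comp eqv_Vl'), ContinuousLinearMap.comp_assoc, Vl'_Vr,
        ContinuousLinearMap.comp_zero, tr_zero])
    (fun j => by
      have e1 : (Vr Γ (ι (j + 1)) (κ (j + 1)) ∘L k (j + 1) ∘L Vl' Γ (ι (j + 1)) (κ (j + 1)))
          ∘L blk (a j) (b j) = Vr Γ (ι (j + 1)) (κ (j + 1)) ∘L k (j + 1) ∘L a j
            ∘L Vl' Γ (ι j) (κ j) := by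
        rw [← Vl'_blk (a j) (b j)]; rfl
      have e2 : blk (a j) (b j) ∘L Vr Γ (ι j) (κ j) ∘L k j ∘L Vl' Γ (ι j) (κ j)
          = Vr Γ (ι (j + 1)) (κ (j + 1)) ∘L b j ∘L k j ∘L Vl' Γ (ι j) (κ j) := by
        rw [← ContinuousLinearMap.comp_assoc (blk (a j) (b j)), blk_Vr]; rfl
      rw [e1, e2, hf, ContinuousLinearMap.sub_comp, ContinuousLinearMap.comp_sub]
      rfl)
    (fun j => by
      calc _ = Vr Γ (ι j) (κ j) ∘L k j ∘L (Vl' Γ (ι j) (κ j) ∘L Vr Γ (ι j) (κ j)) ∘L k j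
            ∘L Vl' Γ (ι j) (κ j) := rfl
        _ = 0 := by rw [Vl'_Vr]; simp)
    (fun j => by
      rw [← ContinuousLinearMap.comp_assoc (blk (a j) (b j)), blk_Vr]
      calc _ = Vr Γ (ι (j + 1)) (κ (j + 1)) ∘L k (j + 1) ∘L
            (Vl' Γ (ι (j + 1)) (κ (j + 1)) ∘L Vr Γ (ι (j + 1)) (κ (j + 1))) ∘L b j ∘L k j
            ∘L Vl' Γ (ι j) (κ j) := rfl
        _ = 0 := by rw [Vl'_Vr]; simp)
    M
  refine h.trans ?_
  rw [← Finset.sum_add_distrib]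
  refine Finset.sum_congr rfl fun j _ => ?_
  rw [lapl_blk, ld_blk (eqv_lapl hea j) (eqv_lapl heb j) (hua j) (hub j) (sa_lapl _ _)
    (sa_lapl _ _), mul_add]

end genericcone

theorem ld_empty {ι : Type} [Fintype ι] [IsEmpty ι] (T : Hn Γ ι →L[ℂ] Hn Γ ι) : ld T = 0 :=
  tr_empty _

/-- differentials of the completion -/
def dd (C : BasedFreeComplex Γ) (j : ℕ) : Hn Γ (C.basis j) →L[ℂ] Hn Γ (C.basis (j + 1)) :=
  RA (C.d j)

theorem dd_dd (C : BasedFreeComplex Γ) (j : ℕ) : dd C (j + 1) ∘L dd C j = 0 := by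
  unfold dd
  rw [← RA_mul, C.dd, RA_zero]

theorem eqv_dd (C : BasedFreeComplex Γ) (j : ℕ) : Eqv (dd C j) := eqv_RA _

theorem lap_eq (C : BasedFreeComplex Γ) (j : ℕ) : C.lap j = lapl (dd C) j := by
  cases j with
  | zero => exact (add_zero _).symm
  | succ j => rfl

theorem torsion_eq (C : BasedFreeComplex Γ) (M : ℕ) (hM : C.N ≤ M) :
    C.torsion = Real.exp ((1 / 2) *
      ∑ j ∈ Finset.range (M + 1), ((-1 : ℝ) ^ j * j) * ld (lapl (dd C) j)) := by
  have h1 : ∑ j ∈ Finset.range (M + 1), ((-1 : ℝ) ^ j * j) * ld (lapl (dd C) j)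
      = ∑ j ∈ Finset.range (C.N + 1), ((-1 : ℝ) ^ j * j) * ld (lapl (dd C) j) := by
    symm
    refine Finset.sum_subset (fun j hj => ?_) fun j _ hj => ?_
    · rw [Finset.mem_range] at hj ⊢
      omega
    · rw [Finset.mem_range] at hj
      haveI := C.bounded j (by omega)
      rw [ld_empty, mul_zero]
  rw [h1, Finset.mul_sum, Real.exp_sum]
  unfold BasedFreeComplex.torsion
  refine Finset.prod_congr rfl fun j _ => ?_
  rw [lap_eq]
  change (Real.exp ((1 / 2) * ld (lapl (dd C) j))) ^ ((-1 : ℤ) ^ j * (j : ℤ)) = _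
  rw [← Real.rpow_intCast, ← Real.exp_mul]
  congr 1
  push_cast
  ring

/-- shifted basis -/
def pb (C : BasedFreeComplex Γ) : ℕ → Type
  | 0 => Empty
  | j + 1 => C.basis j

instance pbFintype (C : BasedFreeComplex Γ) : ∀ j, Fintype (pb C j)
  | 0 => inferInstanceAs (Fintype Empty)
  | j + 1 => C.fintype j

/-- shifted differential -/
def bd (C : BasedFreeComplex Γ) : ∀ j, Hn Γ (pb C j) →L[ℂ] Hn Γ (pb C (j + 1))
  | 0 => 0
  | j + 1 => - dd C j

theorem lapl_bd (C : BasedFreeComplex Γ) (j : ℕ) : lapl (bd C) (j + 1) = lapl (dd C) j := by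
  have hP : PP (bd C) (j + 1) = PP (dd C) j := by
    change ContinuousLinearMap.adjoint (- dd C j) ∘L (- dd C j)
      = ContinuousLinearMap.adjoint (dd C j) ∘L (dd C j)
    rw [map_neg, ContinuousLinearMap.neg_comp, ContinuousLinearMap.comp_neg, neg_neg]
  have hQ : QQ (bd C) (j + 1) = QQ (dd C) j := by
    cases j with
    | zero => exact ContinuousLinearMap.zero_comp _
    | succ j =>
      change (- dd C j) ∘L ContinuousLinearMap.adjoint (- dd C j)
        = dd C j ∘L ContinuousLinearMap.adjoint (dd C j)
      rw [map_neg, ContinuousLinearMap.neg_comp, ContinuousLinearMap.comp_neg, neg_neg]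
  exact congrArg₂ (fun x y : Hn Γ (C.basis j) →L[ℂ] Hn Γ (C.basis j) => x + y) hP hQ

theorem isUnit_bd (C : BasedFreeComplex Γ) (h : ∀ j, IsUnit (lapl (dd C) j)) (j : ℕ) :
    IsUnit (lapl (bd C) j) := by
  cases j with
  | zero =>
    have : lapl (bd C) 0 = 1 := by
      ext1 f
      exact PiLp.ext fun i : Empty => i.elim
    rw [this]
    exact isUnit_one
  | succ j => rw [lapl_bd]; exact h j

theorem bd_bd (C : BasedFreeComplex Γ) (j : ℕ) : bd C (j + 1) ∘L bd C j = 0 := by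
  cases j with
  | zero => exact ContinuousLinearMap.comp_zero _
  | succ j =>
    change (- dd C (j + 1)) ∘L (- dd C j) = 0
    rw [ContinuousLinearMap.neg_comp, ContinuousLinearMap.comp_neg, neg_neg, dd_dd]

theorem eqv_bd (C : BasedFreeComplex Γ) (j : ℕ) : Eqv (bd C j) := by
  cases j with
  | zero => exact Eqv.zero
  | succ j => exact (eqv_dd C j).neg

variable {C C' : BasedFreeComplex Γ}

/-- the map `f`, into the shifted complex -/
def ff (φ : CochainMap C C') (j : ℕ) : Hn Γ (C.basis j) →L[ℂ] Hn Γ (pb C' (j + 1)) :=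
  RA (ι := C'.basis j) (φ.f j)

/-- the homotopy -/
def kk (φ : CochainMap C C') : ∀ j, Hn Γ (C.basis j) →L[ℂ] Hn Γ (pb C' j)
  | 0 => 0
  | j + 1 => - (ctr (dd C') j ∘L RA (φ.f (j + 1)))

theorem eqv_kk (φ : CochainMap C C') (j : ℕ) : Eqv (kk φ j) := by
  cases j with
  | zero => exact Eqv.zero
  | succ j => exact ((eqv_ctr (eqv_dd C') j).comp (eqv_RA _)).neg

theorem ff_eq (φ : CochainMap C C') (hu : ∀ j, IsUnit (lapl (dd C') j)) (j : ℕ) :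
    ff φ j = bd C' j ∘L kk φ j - kk φ (j + 1) ∘L dd C j := by
  have hc : ∀ j, RA (φ.f (j + 1)) ∘L dd C j = dd C' j ∘L RA (φ.f j) := fun j => by
    unfold dd
    rw [← RA_mul, φ.comm, RA_mul]
  have h2 : ∀ j, (- (ctr (dd C') j ∘L RA (φ.f (j + 1)))) ∘L dd C j
      = - ((ctr (dd C') j ∘L dd C' j) ∘L RA (φ.f j)) := fun j => by
    rw [ContinuousLinearMap.neg_comp, ContinuousLinearMap.comp_assoc, hc]
    rfl
  cases j with
  | zero =>
    change RA (φ.f 0) = (0 : Hn Γ (pb C' 0) →L[ℂ] Hn Γ (C'.basis 0)) ∘L kk φ 0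
      - (- (ctr (dd C') 0 ∘L RA (φ.f (0 + 1)))) ∘L dd C 0
    rw [h2, ctr_zero hu, ContinuousLinearMap.zero_comp, zero_sub, neg_neg]
    rfl
  | succ j =>
    change RA (φ.f (j + 1)) = (- dd C' j) ∘L (- (ctr (dd C') j ∘L RA (φ.f (j + 1))))
      - (- (ctr (dd C') (j + 1) ∘L RA (φ.f (j + 1 + 1)))) ∘L dd C (j + 1)
    rw [h2, ContinuousLinearMap.neg_comp, ContinuousLinearMap.comp_neg, neg_neg, sub_neg_eq_add,
      ← ContinuousLinearMap.comp_assoc, ← ContinuousLinearMap.add_comp,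
      add_comm (dd C' j ∘L ctr (dd C') j),
      ctr_succ (dd_dd C') hu]
    rfl

/-- the differential of the cone -/
def cd (φ : CochainMap C C') (j : ℕ) :
    Hn Γ (C.basis j ⊕ pb C' j) →L[ℂ] Hn Γ (C.basis (j + 1) ⊕ pb C' (j + 1)) :=
  blk (dd C j) (bd C' j) + Vr Γ (C.basis (j + 1)) (pb C' (j + 1)) ∘L ff φ j
    ∘L Vl' Γ (C.basis j) (pb C' j)

/-- the cone matrices on the uniform index types -/
def cm (φ : CochainMap C C') : ∀ j, Matrix (C.basis (j + 1) ⊕ pb C' (j + 1))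
    (C.basis j ⊕ pb C' j) (MonoidAlgebra ℤ Γ)
  | 0 => Matrix.fromBlocks (C.d 0) 0 (φ.f 0) (0 : Matrix (C'.basis 0) Empty _)
  | j + 1 => Matrix.fromBlocks (C.d (j + 1)) 0 (φ.f (j + 1))
      (-(C'.d j) : Matrix (C'.basis (j + 1)) (C'.basis j) _)

theorem cd_eq (φ : CochainMap C C') (j : ℕ) : cd φ j = RA (cm φ j) := by
  cases j with
  | zero =>
    refine Eq.trans ?_ (RA_blocks (C.d 0) (φ.f 0) (0 : Matrix (C'.basis 0) Empty _)).symm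
    rw [RA_zero]
    rfl
  | succ j =>
    refine Eq.trans ?_ (RA_blocks (C.d (j + 1)) (φ.f (j + 1)) (-(C'.d j))).symm
    rw [RA_neg]
    rfl

theorem ld_cone (φ : CochainMap C C') (j : ℕ) :
    ld (lapl (dd (mappingCone φ)) j) = ld (lapl (ι := fun j => C.basis j ⊕ pb C' j) (cd φ) j) := by
  have h : cd φ = fun j => RA (cm φ j) := funext (cd_eq φ)
  rw [h]
  match j with
  | 0 => rfl
  | 1 => rfl
  | j + 2 => rfl

theorem main (φ : CochainMap C C') (hC : C.AcyclicWithGap) (hC' : C'.AcyclicWithGap) :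
    (mappingCone φ).torsion = C.torsion * C'.torsion⁻¹ := by
  have hu : ∀ j, IsUnit (lapl (dd C) j) := fun j => by rw [← lap_eq]; exact hC j
  have hu' : ∀ j, IsUnit (lapl (dd C') j) := fun j => by rw [← lap_eq]; exact hC' j
  set m : ℕ := max C.N (C'.N + 1) with hm
  have hm1 : C.N ≤ m := le_max_left _ _
  have hm2 : C'.N + 1 ≤ m := le_max_right _ _
  haveI e1 : IsEmpty (C.basis (m + 1)) := C.bounded _ (by omega)
  haveI e2 : IsEmpty (C.basis (m + 1 + 1)) := C.bounded _ (by omega)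
  haveI e3 : IsEmpty (C'.basis m) := C'.bounded _ (by omega)
  haveI e4 : IsEmpty (pb C' (m + 1)) := e3
  haveI e5 : IsEmpty (pb C' (m + 1 + 1)) := C'.bounded (m + 1) (by omega)
  have hg := generic_cone (dd_dd C) (bd_bd C') hu (isUnit_bd C' hu') (eqv_dd C) (eqv_bd C')
    (ff φ) (kk φ) (eqv_kk φ) (ff_eq φ hu') (m + 1)
  have hN : (mappingCone φ).N ≤ m + 1 := Nat.le_succ m
  rw [torsion_eq _ (m + 1) hN, torsion_eq C (m + 1) (by omega), torsion_eq C' m (by omega)]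
  have hl : ∑ j ∈ Finset.range (m + 1 + 1),
      ((-1 : ℝ) ^ j * j) * ld (lapl (dd (mappingCone φ)) j)
      = ∑ j ∈ Finset.range (m + 1 + 1), ((-1 : ℝ) ^ j * j) * ld (lapl (dd C) j)
        + ∑ j ∈ Finset.range (m + 1 + 1), ((-1 : ℝ) ^ j * j) * ld (lapl (bd C') j) := by
    rw [← hg]
    exact Finset.sum_congr rfl fun j _ => by rw [ld_cone]; rfl
  have hs : ∑ j ∈ Finset.range (m + 1 + 1), ((-1 : ℝ) ^ j * j) * ld (lapl (bd C') j)
      = - ∑ j ∈ Finset.range (m + 1), ((-1 : ℝ) ^ j * j) * ld (lapl (dd C') j) := by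
    have ha := alt_ld (dd_dd C') hu' (eqv_dd C') m
    have hb : ∀ j : ℕ, ((-1 : ℝ) ^ (j + 1) * ((j + 1 : ℕ) : ℝ)) * ld (lapl (bd C') (j + 1))
        = - (((-1 : ℝ) ^ j * j) * ld (lapl (dd C') j)) - (-1 : ℝ) ^ j * ld (lapl (dd C') j) := by
      intro j
      have hj : ld (lapl (bd C') (j + 1)) = ld (lapl (dd C') j) :=
        congrArg (fun x : Hn Γ (C'.basis j) →L[ℂ] Hn Γ (C'.basis j) => ld x) (lapl_bd C' j)
      rw [hj]
      push_cast
      ring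
    rw [Finset.sum_range_succ', Finset.sum_congr rfl fun j _ => hb j, Finset.sum_sub_distrib,
      Finset.sum_neg_distrib, ha]
    simp
  rw [hl, hs, ← Real.exp_neg, ← Real.exp_add]
  congr 1
  ring

end L2T

/-- **`L²` torsion of the mapping cone.**  Let `Γ` be a countable discrete group and
`f : C → C'` a cochain map of based free `ℤΓ`-cochain complexes which is a chain
homotopy equivalence over `ℤΓ`.  If `C`, `C'` and the mapping cone `C_f` are all
`ℓ²`-acyclic with spectral gap, then the `L²` torsion of the mapping cone equals the
quotient of the `L²` torsions:
`∏_j Det_τ(Δ_j^{C_f})^{(-1)^j j} = (∏_j Det_τ(Δ_j)^{(-1)^j j}) · (∏_j Det_τ(Δ'_j)^{(-1)^j j})⁻¹`. -/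
theorem L2_torsion_mapping_cone
    (Γ : Type) [Group Γ] [Countable Γ]
    (C C' : BasedFreeComplex Γ)
    (φ : CochainMap C C') (hφ : φ.IsHomotopyEquivalence)
    (hC : C.AcyclicWithGap) (hC' : C'.AcyclicWithGap)
    (hCf : (mappingCone φ).AcyclicWithGap) :
    (mappingCone φ).torsion = C.torsion * C'.torsion⁻¹ := by
  exact L2T.main φ hC hC'
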